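/- arXiv:2506.17575 — 2 statements merged into one kernel-verified Lean document; each statement's English description precedes it below -/
import Mathlib

section
/- Let 1 < α ≤ 4/3, let β ∈ [0,1] and γ ∈ [0,1] with β + γ > 0, and let T > 0. Then there exists a constant C > 0 (depending only on α, β, γ and T) such that the following holds: for every nondecreasing sequence λ : ℕ → ℝ of positive numbers with λ_0 T^α ≥ 1, every M > 0, and every sequence a : ℕ → ℝ with ∑_n λ_n^{2β} a_n² ≤ M², if b_n := T · E_{α,2}(−λ_n T^α) · a_n and ∑_n b_n² converges, then ∑_n λ_n^{−2γ} a_n² ≤ C · M^{2(1−γ)/(1+β)} · (∑_n b_n²)^{(β+γ)/(1+β)}. -/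
/-- The two-parameter Mittag-Leffler function `E_{α,β}(t) = ∑_{k=0}^∞ t^k / Γ(α k + β)`
on the real line, with `Γ` the real Gamma function. -/
noncomputable def mittagLeffler (α β t : ℝ) : ℝ :=
  ∑' k : ℕ, t ^ k / Real.Gamma (α * k + β)

open PowerSeries in
noncomputable def AA (a : ℝ) : PowerSeries ℝ := PowerSeries.rescale (-1 : ℝ) (PowerSeries.binomialSeries ℝ (-a))

noncomputable def cc (a : ℝ) (n : ℕ) : ℝ := PowerSeries.coeff n (AA a)

lemma AA_add (a b : ℝ) : AA (a + b) = AA a * AA b := by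
  unfold AA
  rw [neg_add, PowerSeries.binomialSeries_add, map_mul]

lemma AA_zero : AA 0 = 1 := by
  unfold AA
  rw [neg_zero, PowerSeries.binomialSeries_zero, map_one]

lemma cc_eq (a : ℝ) (n : ℕ) : cc a n = (-1) ^ n * Ring.choose (-a) n := by
  simp [cc, AA, PowerSeries.coeff_rescale]

lemma cc_zero (a : ℝ) : cc a 0 = 1 := by simp [cc_eq]

lemma choose_succ_mul (r : ℝ) (n : ℕ) :
    Ring.choose r (n+1) * (n+1) = Ring.choose r n * (r - n) := by
  have h1 := Ring.descPochhammer_eq_factorial_smul_choose r (n+1)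
  have h2 := Ring.descPochhammer_eq_factorial_smul_choose r n
  rw [descPochhammer_succ_right] at h1
  simp only [Polynomial.smeval_mul, h2, Polynomial.smeval_sub, Polynomial.smeval_X, Polynomial.smeval_natCast, nsmul_eq_mul, Nat.factorial_succ, pow_one, pow_zero, mul_one] at h1
  push_cast at h1
  have h3 : (n.factorial : ℝ) ≠ 0 := by positivity
  apply mul_left_cancel₀ h3
  linarith

lemma cc_succ (a : ℝ) (n : ℕ) : cc a (n+1) * (n+1) = cc a n * (a + n) := by
  rw [cc_eq, cc_eq, mul_assoc, choose_succ_mul]; ring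

lemma cc_succ' (a : ℝ) (n : ℕ) : cc a (n+1) = cc a n * (a + n) / (n+1) := by
  rw [eq_div_iff (by positivity), cc_succ]

lemma cc_prod (a : ℝ) (n : ℕ) : cc a n = (∏ j ∈ Finset.range n, (a + j)) / n.factorial := by
  induction n with
  | zero => simp [cc_zero]
  | succ n ih =>
    rw [cc_succ', ih, Finset.prod_range_succ, Nat.factorial_succ]
    push_cast
    field_simp

lemma cc_nonneg {a : ℝ} (ha : 0 ≤ a) (n : ℕ) : 0 ≤ cc a n := by
  rw [cc_prod]; positivity

lemma cc_neg {r : ℝ} (h0 : 0 ≤ r) (h1 : r ≤ 1) (n : ℕ) : cc (-r) (n+1) ≤ 0 := by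
  induction n with
  | zero => rw [cc_succ']; simp [cc_zero, h0]
  | succ n ih =>
    rw [cc_succ']
    apply div_nonpos_of_nonpos_of_nonneg _ (by positivity)
    apply mul_nonpos_of_nonpos_of_nonneg ih
    push_cast
    have : (0:ℝ) ≤ n := by positivity
    linarith

/-- domination -/
lemma cc_bound (b : ℝ) (hb : 1 ≤ b) (J n : ℕ) (hn : J ≤ n) :
    cc (b + 1) n ≤ (1 + b) ^ J * (((n:ℝ) + 1) / (J + 1)) ^ b := by
  induction n, hn using Nat.le_induction with
  | base =>
    rw [div_self (by positivity), Real.one_rpow, mul_one]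
    induction J with
    | zero => simp [cc_zero]
    | succ J ih =>
      rw [cc_succ', pow_succ, mul_div_assoc]
      gcongr
      rw [div_le_iff₀ (by positivity)]
      have : (0:ℝ) ≤ J := by positivity
      nlinarith
  | succ n hn ih =>
    rw [cc_succ', mul_div_assoc]
    have h1 : (b + 1 + n) / ((n:ℝ) + 1) ≤ ((n + 1 + 1) / ((n:ℝ) + 1)) ^ b := by
      have h2 := one_add_mul_self_le_rpow_one_add (s := 1 / ((n:ℝ)+1)) (by have : 0 ≤ 1 / ((n:ℝ)+1) := by positivity
                                                                           linarith) hb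
      have e1 : (b + 1 + n) / ((n:ℝ) + 1) = 1 + b * (1 / (n+1)) := by field_simp; ring
      have e2 : (n + 1 + 1) / ((n:ℝ) + 1) = 1 + (1 / (n+1)) := by field_simp
      rw [e1, e2]; exact h2
    calc _ ≤ ((1 + b) ^ J * (((n:ℝ) + 1) / (J + 1)) ^ b) * ((n + 1 + 1) / ((n:ℝ) + 1)) ^ b := by
          gcongr
      _ = _ := by
          rw [mul_assoc, ← Real.mul_rpow (by positivity) (by positivity)]
          push_cast
          congr 2
          field_simp

lemma cc_tendsto (a : ℝ) (ha : 0 < a) :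
    Filter.Tendsto (fun n : ℕ => (n:ℝ) ^ (1 - a) * cc a n) Filter.atTop (nhds (1 / Real.Gamma a)) := by
  have h1 := Real.GammaSeq_tendsto_Gamma a
  have h2 := h1.inv₀ (Real.Gamma_pos_of_pos ha).ne'
  have h3 : Filter.Tendsto (fun n : ℕ => (n:ℝ) / (n + a)) Filter.atTop (nhds 1) := 
    tendsto_natCast_div_add_atTop a
  have h4 := h2.mul h3
  rw [mul_one, ← one_div] at h4
  refine h4.congr' ?_
  filter_upwards [Filter.eventually_gt_atTop 0] with n hn
  have hn' : (0:ℝ) < n := by exact_mod_cast hn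
  have hp : 0 < ∏ j ∈ Finset.range n, (a + j) := Finset.prod_pos (fun j _ => by positivity)
  rw [Real.GammaSeq, cc_prod, Finset.prod_range_succ, Real.rpow_sub hn', Real.rpow_one]
  have := Real.rpow_pos_of_pos hn' a
  field_simp
  ring

noncomputable def pp (α y : ℝ) (n : ℕ) : ℝ := ∑' k : ℕ, (-y) ^ k * cc (α * k + 2) n

lemma summable_aux (α r : ℝ) (hα1 : 1 < α) (hα2 : α ≤ 4 / 3) (hr0 : 0 ≤ r) (hr1 : r < 1) (J : ℕ) :
    Summable (fun k : ℕ => r ^ k * (α * k + 2) ^ J) := by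
  have h1 : Summable (fun k : ℕ => ((k + 1 : ℕ) : ℝ) ^ J * ((1 + r)/2) ^ (k+1)) := by
    have := summable_pow_mul_geometric_of_norm_lt_one (R := ℝ) J (r := (1 + r)/2) (by
      rw [Real.norm_of_nonneg (by linarith)]; linarith)
    exact (summable_nat_add_iff 1).2 this
  have h2 := h1.mul_left (2 ^ J * (2 / (1 + r)))
  refine Summable.of_nonneg_of_le (fun k => by positivity) (fun k => ?_) h2
  have e : 2 ^ J * (2 / (1 + r)) * (((k + 1 : ℕ) : ℝ) ^ J * ((1 + r)/2) ^ (k+1))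
      = ((1 + r)/2) ^ k * (2 * ((k:ℝ) + 1)) ^ J := by
    have : 1 + r ≠ 0 := by linarith
    rw [mul_pow, pow_succ ((1 + r)/2)]
    push_cast
    field_simp
  rw [e]
  have : (0:ℝ) ≤ k := by positivity
  gcongr
  · linarith
  · nlinarith

lemma summable_pp (α y : ℝ) (hα1 : 1 < α) (hα2 : α ≤ 4 / 3) (hy0 : 0 ≤ y) (hy1 : y < 1) (n : ℕ) :
    Summable (fun k : ℕ => (-y) ^ k * cc (α * k + 2) n) := by
  refine Summable.of_norm_bounded (summable_aux α y hα1 hα2 hy0 hy1 n) (fun k => ?_)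
  have hk : (0:ℝ) ≤ k := by positivity
  rw [norm_mul, norm_pow, norm_neg, Real.norm_of_nonneg hy0,
    Real.norm_of_nonneg (cc_nonneg (by positivity) n)]
  gcongr
  have := cc_bound (α * k + 1) (by nlinarith) n n le_rfl
  rw [div_self (by positivity), Real.one_rpow, mul_one] at this
  rwa [show α * k + 1 + 1 = α * k + 2 by ring, show 1 + (α * k + 1) = α * k + 2 by ring] at this

lemma pp_tendsto (α x : ℝ) (hα1 : 1 < α) (hα2 : α ≤ 4 / 3) (hx : 0 < x) :
    Filter.Tendsto (fun n : ℕ => (n:ℝ)⁻¹ * pp α (x * (n:ℝ) ^ (-α)) n) Filter.atTop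
      (nhds (mittagLeffler α 2 (-x))) := by
  obtain ⟨J, hJ1, hJ⟩ : ∃ J : ℕ, 1 ≤ J ∧ x * (2 / ((J:ℝ) + 1)) ^ α ≤ 1 / 2 := by
    have h1 : Filter.Tendsto (fun J : ℕ => 2 / ((J:ℝ) + 1)) Filter.atTop (nhds 0) := by
      have := (tendsto_one_div_add_atTop_nhds_zero_nat (𝕜 := ℝ)).const_mul 2
      simpa [div_eq_mul_inv] using this
    have h2 := (h1.rpow_const (p := α) (Or.inr (by linarith))).const_mul x
    rw [Real.zero_rpow (by linarith), mul_zero] at h2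
    have h3 := h2.eventually_le_const (v := (0:ℝ)) (u := 1/2) (by norm_num)
    obtain ⟨J, h4, h5⟩ := (h3.and (Filter.eventually_ge_atTop 1)).exists
    exact ⟨J, h5, h4⟩
  set q : ℝ := 2 / ((J:ℝ) + 1) with hq
  have hq0 : 0 < q := by positivity
  have hS : Summable (fun k : ℕ => q * ((1/2 : ℝ) ^ k * (α * k + 2) ^ J)) :=
    (summable_aux α (1/2) hα1 hα2 (by norm_num) (by norm_num) J).mul_left q
  unfold mittagLeffler pp
  simp_rw [← tsum_mul_left]
  refine tendsto_tsum_of_dominated_convergence hS (fun k => ?_) ?_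
  · have h := (cc_tendsto (α * k + 2) (by positivity)).const_mul ((-x) ^ k)
    rw [mul_one_div] at h
    refine h.congr' ?_
    filter_upwards [Filter.eventually_gt_atTop 0] with n hn
    have hn' : (0:ℝ) < n := by exact_mod_cast hn
    have e : (n:ℝ) ^ (1 - (α * k + 2)) = (n:ℝ)⁻¹ * ((n:ℝ) ^ (-α)) ^ k := by
      rw [← Real.rpow_natCast, ← Real.rpow_mul hn'.le, ← Real.rpow_neg_one, ← Real.rpow_add hn']
      congr 1; ring
    rw [e, neg_mul_eq_neg_mul, mul_pow]; ring
  · filter_upwards [Filter.eventually_ge_atTop J] with n hn k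
    have hn1 : (1:ℝ) ≤ n := by exact_mod_cast hJ1.trans hn
    have hn' : (0:ℝ) < n := by linarith
    have hk : (0:ℝ) ≤ k := by positivity
    have hb := cc_bound (α * k + 1) (by nlinarith) J n hn
    rw [norm_mul, norm_mul, norm_pow, norm_neg, norm_mul, Real.norm_of_nonneg hx.le,
      Real.norm_of_nonneg (cc_nonneg (by positivity) n), Real.norm_of_nonneg (by positivity), Real.norm_of_nonneg (by positivity)]
    have h2 : (((n:ℝ) + 1) / (J + 1)) ^ (α * k + 1) ≤ (n:ℝ) ^ (α * k + 1) * q ^ (α * k + 1) := by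
      rw [← Real.mul_rpow (by positivity) (by positivity)]
      apply Real.rpow_le_rpow (by positivity) _ (by positivity)
      rw [hq, mul_div_assoc']
      gcongr
      linarith
    have e : (n:ℝ)⁻¹ * (x * (n:ℝ) ^ (-α)) ^ k * (n:ℝ) ^ (α * k + 1) = x ^ k := by
      rw [mul_pow, ← Real.rpow_natCast ((n:ℝ) ^ (-α)), ← Real.rpow_mul hn'.le, ← Real.rpow_neg_one]
      have : (n:ℝ) ^ (-1 : ℝ) * (n:ℝ) ^ (-α * k) * (n:ℝ) ^ (α * k + 1) = 1 := by
        rw [← Real.rpow_add hn', ← Real.rpow_add hn']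
        convert Real.rpow_zero _ using 2; ring
      linear_combination x ^ k * this
    have e2 : q ^ (α * k + 1) = q * (q ^ α) ^ k := by
      rw [Real.rpow_add hq0, Real.rpow_one, Real.rpow_mul hq0.le, Real.rpow_natCast, mul_comm]
    calc (n:ℝ)⁻¹ * ((x * (n:ℝ) ^ (-α)) ^ k * cc (α * k + 2) n)
        ≤ (n:ℝ)⁻¹ * ((x * (n:ℝ) ^ (-α)) ^ k * ((α * k + 2) ^ J * ((n:ℝ) ^ (α * k + 1) * q ^ (α * k + 1)))) := by
          gcongr
          refine le_trans (le_of_eq (by congr 1; ring)) (hb.trans ?_)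
          rw [show 1 + (α * k + 1) = α * k + 2 by ring]
          gcongr
      _ = ((n:ℝ)⁻¹ * (x * (n:ℝ) ^ (-α)) ^ k * (n:ℝ) ^ (α * k + 1)) * q ^ (α * k + 1) * (α * k + 2) ^ J := by ring
      _ = q * ((x * q ^ α) ^ k * (α * k + 2) ^ J) := by rw [e, e2, mul_pow]; ring
      _ ≤ _ := by gcongr

open PowerSeries in
lemma pp_formal (α y : ℝ) (hα1 : 1 < α) (hα2 : α ≤ 4 / 3) (hy0 : 0 ≤ y) (hy1 : y < 1) :
    (AA (-α) + C y) * mk (pp α y) = AA (2 - α) := by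
  ext n
  rw [add_mul, map_add, coeff_C_mul, coeff_mk, coeff_mul]
  simp only [coeff_mk]
  have hs := fun j => summable_pp α y hα1 hα2 hy0 hy1 j
  have h1 : ∑ p ∈ Finset.HasAntidiagonal.antidiagonal n, coeff p.1 (AA (-α)) * pp α y p.2
      = ∑' k : ℕ, (-y) ^ k * cc (α * k + 2 - α) n := by
    unfold pp
    simp_rw [← tsum_mul_left]
    have hsw := Summable.tsum_finsetSum (s := Finset.HasAntidiagonal.antidiagonal n)
      (f := fun (p : ℕ × ℕ) (k : ℕ) => coeff p.1 (AA (-α)) * ((-y) ^ k * cc (α * k + 2) p.2))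
      (fun p _ => (hs p.2).mul_left _)
    rw [← hsw]
    congr 1; ext k
    have : cc (α * k + 2 - α) n = ∑ p ∈ Finset.HasAntidiagonal.antidiagonal n, coeff p.1 (AA (-α)) * cc (α * k + 2) p.2 := by
      rw [cc, show α * k + 2 - α = -α + (α * k + 2) by ring, AA_add, coeff_mul]; rfl
    rw [this, Finset.mul_sum]
    refine Finset.sum_congr rfl (fun p _ => by ring)
  have h2 : ∀ k : ℕ, (-y) ^ (k+1) * cc (α * ((k+1 : ℕ):ℝ) + 2 - α) n = -y * ((-y) ^ k * cc (α * k + 2) n) := by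
    intro k
    push_cast
    rw [show α * ((k:ℝ)+1) + 2 - α = α * k + 2 by ring]; ring
  have hs2 : Summable (fun k : ℕ => (-y) ^ k * cc (α * k + 2 - α) n) := by
    rw [← summable_nat_add_iff 1]
    simp_rw [h2]
    exact (hs n).mul_left _
  rw [h1, hs2.tsum_eq_zero_add]
  simp_rw [h2]
  rw [tsum_mul_left]
  change _ + y * pp α y n = cc (2 - α) n
  unfold pp
  simp

noncomputable def dd (η : ℝ) (m : ℕ) : ℝ := 1 - (((1 - Complex.I * η)⁻¹ : ℂ) ^ (m+1)).re

lemma kap_ne (η : ℝ) : (1 - Complex.I * η : ℂ) ≠ 0 := by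
  intro h
  have := congrArg Complex.re h
  simp at this

open PowerSeries in
lemma ee_formal (η : ℝ) :
    ((1 - X) ^ 2 + C (η ^ 2)) * mk (fun m => (((1 - Complex.I * η)⁻¹ : ℂ) ^ (m+1)).re) = (1 - X : PowerSeries ℝ) := by
  set κ : ℂ := (1 - Complex.I * η)⁻¹ with hκ
  have hq : (1 + (η:ℂ) ^ 2) * κ ^ 2 - 2 * κ + 1 = 0 := by
    have h0 := kap_ne η
    have hk : (1 - Complex.I * η) * κ = 1 := mul_inv_cancel₀ h0
    linear_combination (-1 + κ + Complex.I * η * κ) * hk + (η:ℂ)^2 * κ ^ 2 * Complex.I_sq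
  have hq1 : (1 + (η:ℂ) ^ 2) * κ = 1 + Complex.I * η := by
    have h0 := kap_ne η
    have hk : (1 - Complex.I * η) * κ = 1 := mul_inv_cancel₀ h0
    linear_combination (1 + Complex.I * η) * hk + (η:ℂ)^2 * κ * Complex.I_sq
  obtain ⟨u, hu⟩ : ∃ u : ℝ, u = 1 + η ^ 2 := ⟨_, rfl⟩
  have hre : ∀ z : ℂ, ((1 + (η:ℂ) ^ 2) * z).re = u * z.re := by
    intro z
    rw [hu, show (1 + (η:ℂ) ^ 2) = ((1 + η ^ 2 : ℝ) : ℂ) by push_cast; ring, Complex.re_ofReal_mul]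
  have e : ((1 - X) ^ 2 + C (η ^ 2)) * mk (fun m => (κ ^ (m+1)).re)
     = C u * mk (fun m => (κ ^ (m+1)).re) - C 2 * (X * mk (fun m => (κ ^ (m+1)).re))
       + X * (X * mk (fun m => (κ ^ (m+1)).re)) := by
    have c1 : (C (1 + η^2) : PowerSeries ℝ) = 1 + C (η^2) := by simp
    have c2 : (C 2 : PowerSeries ℝ) = 2 := rfl
    rw [hu, c1, c2]; ring
  rw [e]
  ext n
  rcases n with _ | _ | n
  · have := congrArg Complex.re hq1
    rw [hre] at this
    simp only [map_add, map_sub, coeff_C_mul, coeff_mk, coeff_zero_X_mul, coeff_zero_X, coeff_zero_one, zero_add, pow_one]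
    simp at this
    linarith
  · have := congrArg Complex.re hq
    rw [Complex.add_re, Complex.sub_re, hre] at this
    simp at this
    simp only [map_add, map_sub, coeff_C_mul, coeff_succ_X_mul, coeff_mk, zero_add, coeff_one_X, coeff_one, coeff_zero_X_mul]
    norm_num
    linarith
  · have := congrArg (fun z => (z * κ ^ (n+1)).re) hq
    have e2 : ((1 + (η:ℂ) ^ 2) * κ ^ 2 - 2 * κ + 1) * κ ^ (n+1) = 
       (1 + (η:ℂ) ^ 2) * κ ^ (n+1+1+1) - 2 * κ ^ (n+1+1) + κ ^ (n+1) := by ring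
    rw [e2, Complex.add_re, Complex.sub_re, hre] at this
    simp only [map_add, map_sub, coeff_C_mul, coeff_succ_X_mul, coeff_mk, coeff_X, coeff_one]
    simp at this
    norm_num
    linarith

open PowerSeries in
lemma dd_formal (η : ℝ) :
    (1 - X) * ((1 - X) ^ 2 + C (η ^ 2)) * mk (dd η) = (C (η ^ 2) : PowerSeries ℝ) := by
  have h := ee_formal η
  have h1 : mk (dd η) = mk 1 - mk (fun m => (((1 - Complex.I * η)⁻¹ : ℂ) ^ (m+1)).re) := by
    ext n; simp [dd]
  have h2 := PowerSeries.mk_one_mul_one_sub_eq_one ℝ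
  rw [h1, mul_sub]
  linear_combination ((1 - X) ^ 2 + C (η ^ 2)) * h2 - (1 - X) * h

open PowerSeries in
lemma pp_subst (α η : ℝ) (hα1 : 1 < α) (hα2 : α ≤ 4 / 3) (hη1 : η ^ 2 < 1) :
    C (η ^ 2) * mk (pp α (η ^ 2)) = AA (2 - α - α / 2) * (mk (dd η)).subst (1 - AA (-(α/2))) := by
  have hs : HasSubst (1 - AA (-(α/2))) := by
    apply HasSubst.of_constantCoeff_zero'
    rw [← coeff_zero_eq_constantCoeff_apply, map_sub]
    have := cc_zero (-(α/2))
    rw [cc] at this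
    simp [this]
  have h := congrArg (substAlgHom (R := ℝ) hs) (dd_formal η)
  have hC : substAlgHom (R := ℝ) hs (C (η ^ 2)) = C (η ^ 2) := by
    rw [coe_substAlgHom]; exact subst_C _
  have hX : substAlgHom (R := ℝ) hs X = 1 - AA (-(α/2)) := substAlgHom_X hs
  rw [map_mul, map_mul, map_add, map_pow, map_sub, map_one, hX, hC] at h
  rw [coe_substAlgHom] at h
  set S := (mk (dd η)).subst (1 - AA (-(α/2)))
  have hf := pp_formal α (η ^ 2) hα1 hα2 (by positivity) hη1
  have e1 : AA (-α) = AA (-(α/2)) ^ 2 := by rw [sq, ← AA_add]; congr 1; ring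
  have e2 : AA (2 - α) * AA (-(α/2)) = AA (2 - α - α/2) := by rw [← AA_add]; congr 1
  have e3 : AA (-(α/2)) * AA (α/2) = 1 := by rw [← AA_add, neg_add_cancel, AA_zero]
  have hne : AA (-α) + C (η ^ 2) ≠ 0 := by
    intro h0
    have := congrArg (coeff 0) h0
    rw [map_add] at this
    have h1 := cc_zero (-α)
    rw [cc] at h1
    rw [h1] at this
    simp at this
    nlinarith [sq_nonneg η]
  apply mul_left_cancel₀ hne
  rw [sub_sub_cancel] at h
  calc (AA (-α) + C (η ^ 2)) * (C (η ^ 2) * mk (pp α (η ^ 2))) = C (η ^ 2) * AA (2 - α) := by rw [← hf]; ring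
    _ = _ := by
      rw [← e2, e1]; linear_combination (-AA (2 - α)) * h

lemma gam_int (η : ℝ) (m : ℕ) :
    MeasureTheory.IntegrableOn (fun t : ℝ => (t:ℂ) ^ m * Complex.exp (-((1 - Complex.I * η) * t))) (Set.Ioi 0) := by
  have h := Real.GammaIntegral_convergent (s := m + 1) (by positivity)
  refine MeasureTheory.Integrable.mono' h (Continuous.aestronglyMeasurable (by fun_prop)) ?_
  refine (MeasureTheory.ae_restrict_mem measurableSet_Ioi).mono (fun t ht => ?_)
  have ht' : (0:ℝ) < t := ht
  rw [norm_mul, norm_pow, Complex.norm_real, Complex.norm_exp, add_sub_cancel_right, Real.rpow_natCast, Real.norm_of_nonneg ht'.le]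
  simp
  rw [mul_comm]

lemma gam_val (η : ℝ) (m : ℕ) :
    ∫ t in Set.Ioi (0:ℝ), (t:ℂ) ^ m * Complex.exp (-((1 - Complex.I * η) * t))
      = m.factorial * ((1 - Complex.I * η)⁻¹ : ℂ) ^ (m+1) := by
  have h0 := kap_ne η
  have hlim : ∀ m : ℕ, Filter.Tendsto (fun t : ℝ => (t:ℂ) ^ m * Complex.exp (-((1 - Complex.I * η) * t))) Filter.atTop (nhds 0) := by
    intro m
    rw [tendsto_zero_iff_norm_tendsto_zero]
    refine (Real.tendsto_pow_mul_exp_neg_atTop_nhds_zero m).congr' ?_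
    filter_upwards [Filter.eventually_gt_atTop 0] with t ht
    rw [norm_mul, norm_pow, Complex.norm_real, Complex.norm_exp, Real.norm_of_nonneg ht.le]
    simp
  have hd : ∀ t : ℝ, HasDerivAt (fun t : ℝ => Complex.exp (-((1 - Complex.I * η) * t))) (-(1 - Complex.I * η) * Complex.exp (-((1 - Complex.I * η) * t))) t := by
    intro t
    have h1 : HasDerivAt (fun z : ℂ => Complex.exp (-((1 - Complex.I * η) * z))) (-(1 - Complex.I * η) * Complex.exp (-((1 - Complex.I * η) * t))) (t:ℂ) := by
      have h2 : HasDerivAt (fun z : ℂ => -((1 - Complex.I * η) * z)) (-((1 - Complex.I * η) * 1)) (t:ℂ) :=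
        ((hasDerivAt_id (t:ℂ)).const_mul (1 - Complex.I * η : ℂ)).neg
      refine h2.cexp.congr_deriv ?_
      ring
    exact h1.comp_ofReal
  induction m with
  | zero =>
    have h1 := MeasureTheory.integral_Ioi_of_hasDerivAt_of_tendsto (a := 0) (f := fun t : ℝ => Complex.exp (-((1 - Complex.I * η) * t)))
      (f' := fun t : ℝ => (-(1 - Complex.I * η) * Complex.exp (-((1 - Complex.I * η) * t)))) (m := 0)
      (by fun_prop) (fun t _ => hd t) (by have := (gam_int η 0).const_mul (-(1 - Complex.I * η)); simp only [pow_zero, one_mul] at this; exact this) (by simpa using hlim 0)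
    rw [MeasureTheory.integral_const_mul] at h1
    simp only [pow_zero, one_mul, Nat.factorial_zero, Nat.cast_one, zero_add, pow_one]
    simp only [Complex.ofReal_zero, mul_zero, neg_zero, Complex.exp_zero] at h1
    apply mul_left_cancel₀ h0
    rw [mul_inv_cancel₀ h0]
    linear_combination -h1
  | succ m ih =>
    have h1 := MeasureTheory.integral_Ioi_of_hasDerivAt_of_tendsto (a := 0) (f := fun t : ℝ => (t:ℂ) ^ (m+1) * Complex.exp (-((1 - Complex.I * η) * t)))
      (f' := fun t : ℝ => ((m:ℂ)+1) * ((t:ℂ) ^ m * Complex.exp (-((1 - Complex.I * η) * t))) + (-(1 - Complex.I * η)) * ((t:ℂ) ^ (m+1) * Complex.exp (-((1 - Complex.I * η) * t)))) (m := 0)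
      (by fun_prop) (fun t _ => by
        have h2 := (hasDerivAt_pow (m+1) (t:ℂ)).comp_ofReal.mul (hd t)
        refine h2.congr_deriv ?_
        push_cast
        ring)
      (((gam_int η m).const_mul _).add ((gam_int η (m+1)).const_mul _)) (hlim (m+1))
    rw [MeasureTheory.integral_add ((gam_int η m).const_mul _) ((gam_int η (m+1)).const_mul _),
      MeasureTheory.integral_const_mul, MeasureTheory.integral_const_mul, ih] at h1
    simp only [Complex.ofReal_zero, zero_pow (Nat.succ_ne_zero m), zero_mul, sub_zero] at h1
    rw [Nat.factorial_succ]
    push_cast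
    apply mul_left_cancel₀ h0
    have hk : (1 - Complex.I * η) * (1 - Complex.I * η : ℂ)⁻¹ = 1 := mul_inv_cancel₀ h0
    rw [pow_succ _ (m+1)]
    linear_combination -h1 - ((m:ℂ)+1) * m.factorial * ((1 - Complex.I * η)⁻¹ : ℂ) ^ (m+1) * hk

lemma gam_re (η : ℝ) (m : ℕ) :
    MeasureTheory.IntegrableOn (fun t : ℝ => t ^ m * Real.exp (-t) * Real.cos (η * t)) (Set.Ioi 0) ∧
    m.factorial * (((1 - Complex.I * η)⁻¹ : ℂ) ^ (m+1)).re = ∫ t in Set.Ioi (0:ℝ), t ^ m * Real.exp (-t) * Real.cos (η * t) := by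
  have e : ∀ t : ℝ, ((t:ℂ) ^ m * Complex.exp (-((1 - Complex.I * η) * t))).re = t ^ m * Real.exp (-t) * Real.cos (η * t) := by
    intro t
    rw [← Complex.ofReal_pow, Complex.re_ofReal_mul, Complex.exp_re]
    simp [mul_assoc]
  have h1 := (gam_int η m).re
  have h2 := integral_re (gam_int η m)
  rw [gam_val] at h2
  simp only [RCLike.re_to_complex, e] at h1 h2
  refine ⟨h1, ?_⟩
  rw [h2, ← Complex.ofReal_natCast, Complex.re_ofReal_mul]

lemma dd_integral (η : ℝ) (m : ℕ) :
    MeasureTheory.IntegrableOn (fun t : ℝ => t ^ m * Real.exp (-t) * (1 - Real.cos (η * t))) (Set.Ioi 0) ∧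
    m.factorial * dd η m = ∫ t in Set.Ioi (0:ℝ), t ^ m * Real.exp (-t) * (1 - Real.cos (η * t)) := by
  obtain ⟨i1, h1⟩ := gam_re η m
  obtain ⟨i0, h0⟩ := gam_re 0 m
  simp at i0 h0
  have e : (fun t : ℝ => t ^ m * Real.exp (-t) * (1 - Real.cos (η * t))) =
      fun t => t ^ m * Real.exp (-t) - t ^ m * Real.exp (-t) * Real.cos (η * t) := by
    ext t; ring
  rw [e]
  refine ⟨i0.sub i1, ?_⟩
  rw [MeasureTheory.integral_sub i0 i1, ← h1, ← h0, dd]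
  ring

lemma dd_double (η : ℝ) (m : ℕ) : dd (2 * η) m ≤ 4 * dd η m := by
  obtain ⟨i1, h1⟩ := dd_integral η m
  obtain ⟨i2, h2⟩ := dd_integral (2 * η) m
  have hf : (0:ℝ) < m.factorial := by positivity
  apply le_of_mul_le_mul_left _ hf
  rw [mul_left_comm, h1, h2, ← MeasureTheory.integral_const_mul]
  apply MeasureTheory.setIntegral_mono_on i2 (i1.const_mul 4) measurableSet_Ioi
  intro t ht
  have ht' : (0:ℝ) < t := ht
  have hp : 0 ≤ t ^ m * Real.exp (-t) := by positivity
  rw [mul_left_comm]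
  apply mul_le_mul_of_nonneg_left _ hp
  rw [mul_assoc, Real.cos_two_mul]
  nlinarith [sq_nonneg (Real.cos (η * t) - 1)]

open PowerSeries in
lemma pp_double (α η : ℝ) (hα1 : 1 < α) (hα2 : α ≤ 4 / 3) (hη : 0 < η) (hη1 : (2 * η) ^ 2 < 1) (n : ℕ) :
    pp α (4 * η ^ 2) n ≤ pp α (η ^ 2) n := by
  have h1 := pp_subst α η hα1 hα2 (by nlinarith)
  have h2 := pp_subst α (2 * η) hα1 hα2 hη1
  have h1n := congrArg (coeff n) h1
  have h2n := congrArg (coeff n) h2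
  have hs : HasSubst (1 - AA (-(α/2))) := by
    apply HasSubst.of_constantCoeff_zero'
    rw [← coeff_zero_eq_constantCoeff_apply, map_sub]
    have := cc_zero (-(α/2))
    rw [cc] at this
    simp [this]
  have hC : ∀ i, 0 ≤ coeff i (1 - AA (-(α/2))) := by
    intro i
    cases i with
    | zero =>
      have := cc_zero (-(α/2))
      rw [cc] at this
      rw [map_sub, this]
      simp
    | succ i =>
      have := cc_neg (r := α/2) (by linarith) (by linarith) i
      rw [cc] at this
      rw [map_sub, coeff_one]
      simpa using this
  have hCp : ∀ m i, 0 ≤ coeff i ((1 - AA (-(α/2))) ^ m) := by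
    intro m
    induction m with
    | zero => intro i; rw [pow_zero, coeff_one]; split_ifs <;> norm_num
    | succ m ih =>
      intro i
      rw [pow_succ, coeff_mul]
      exact Finset.sum_nonneg (fun p _ => mul_nonneg (ih _) (hC _))
  have hS : ∀ i, coeff i ((mk (dd (2 * η))).subst (1 - AA (-(α/2)))) ≤ 4 * coeff i ((mk (dd η)).subst (1 - AA (-(α/2)))) := by
    intro i
    rw [coeff_subst' hs, coeff_subst' hs, ← smul_eq_mul 4, smul_finsum]
    have hf1 := coeff_subst_finite' hs (mk (dd (2 * η))) i
    have hf2 := coeff_subst_finite' hs (mk (dd η)) i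
    have hf3 : (Function.support fun d => (4:ℝ) • (coeff d (mk (dd η)) • coeff i ((1 - AA (-(α/2))) ^ d))).Finite :=
      hf2.subset (by
        intro m hm hm2
        apply hm
        simp only at hm2
        simp only [hm2, smul_zero])
    rw [finsum_eq_sum_of_support_subset (s := (hf1.union hf3).toFinset) _ (by simp),
      finsum_eq_sum_of_support_subset (s := (hf1.union hf3).toFinset) _ (by simp)]
    apply Finset.sum_le_sum
    · intro m _
      simp only [coeff_mk, smul_eq_mul]
      rw [← mul_assoc]
      exact mul_le_mul_of_nonneg_right (dd_double η m) (hCp m i)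
  rw [coeff_C_mul, coeff_mk, coeff_mul] at h1n h2n
  have h3 : (2 * η) ^ 2 * pp α ((2 * η) ^ 2) n ≤ 4 * (η ^ 2 * pp α (η ^ 2) n) := by
    rw [h1n, h2n, Finset.mul_sum]
    apply Finset.sum_le_sum
    intro p _
    rw [mul_left_comm]
    exact mul_le_mul_of_nonneg_left (hS _) (cc_nonneg (by linarith) _)
  rw [show 4 * η ^ 2 = (2 * η) ^ 2 by ring]
  have : 0 < 4 * η ^ 2 := by positivity
  apply le_of_mul_le_mul_left _ this
  linarith

noncomputable def ff (ρ : ℝ) : PowerSeries ℝ := 1 - AA (-ρ)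

lemma cc_one (n : ℕ) : cc 1 n = 1 := by
  induction n with
  | zero => exact cc_zero 1
  | succ n ih =>
    rw [cc_succ', ih]
    have : (n:ℝ) + 1 ≠ 0 := by positivity
    field_simp
    ring

lemma cc_mono {a : ℝ} (ha : 1 ≤ a) : Monotone (cc a) := by
  apply monotone_nat_of_le_succ
  intro n
  have h := cc_nonneg (by linarith : 0 ≤ a) n
  rw [cc_succ', le_div_iff₀ (by positivity)]
  nlinarith

lemma cc_anti {a : ℝ} (ha0 : 0 ≤ a) (ha : a ≤ 1) : Antitone (cc a) := by
  apply antitone_nat_of_succ_le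
  intro n
  have h := cc_nonneg ha0 n
  rw [cc_succ', div_le_iff₀ (by positivity)]
  nlinarith

open PowerSeries in
lemma ff_nonneg {ρ : ℝ} (h0 : 0 ≤ ρ) (h1 : ρ ≤ 1) (i : ℕ) : 0 ≤ coeff i (ff ρ) := by
  unfold ff
  cases i with
  | zero =>
    have := cc_zero (-ρ)
    rw [cc] at this
    rw [map_sub, this]
    simp
  | succ i =>
    have := cc_neg h0 h1 i
    rw [cc] at this
    rw [map_sub, coeff_one]
    simpa using this

open PowerSeries in
lemma ffp_nonneg {ρ : ℝ} (h0 : 0 ≤ ρ) (h1 : ρ ≤ 1) (m i : ℕ) : 0 ≤ coeff i (ff ρ ^ m) := by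
  induction m generalizing i with
  | zero => rw [pow_zero, coeff_one]; split_ifs <;> norm_num
  | succ m ih =>
    rw [pow_succ, coeff_mul]
    exact Finset.sum_nonneg (fun p _ => mul_nonneg (ih _) (ff_nonneg h0 h1 _))

open PowerSeries in
lemma coeff_AA_one (φ : PowerSeries ℝ) (n : ℕ) :
    coeff n (AA 1 * φ) = ∑ j ∈ Finset.range (n+1), coeff j φ := by
  rw [mul_comm, coeff_mul, Finset.Nat.sum_antidiagonal_eq_sum_range_succ_mk]
  apply Finset.sum_congr rfl
  intro j _
  have := cc_one (n - j)
  rw [cc] at this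
  simp only [this, mul_one]

open PowerSeries in
noncomputable def Pm (ρ : ℝ) (m n : ℕ) : ℝ := ∑ j ∈ Finset.range (n+1), coeff j (ff ρ ^ m)

open PowerSeries in
lemma Pm_mono {ρ : ℝ} (h0 : 0 ≤ ρ) (h1 : ρ ≤ 1) (m : ℕ) : Monotone (Pm ρ m) := by
  intro i j hij
  unfold Pm
  apply Finset.sum_le_sum_of_subset_of_nonneg
  · intro k; simp; omega
  · intro k _ _; exact ffp_nonneg h0 h1 m k

open PowerSeries in
lemma geo (ρ b : ℝ) (m : ℕ) :
    AA b * (1 - ff ρ ^ m) = ∑ i ∈ Finset.range m, AA (b - ρ) * ff ρ ^ i := by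
  rw [← geom_sum_mul_neg, ← Finset.mul_sum]
  have : AA (b - ρ) = AA b * (1 - ff ρ) := by
    unfold ff; rw [sub_sub_cancel, ← AA_add]; rfl
  rw [this]; ring

open PowerSeries in
lemma mul_nonneg_coeff {φ ψ : PowerSeries ℝ} (h : ∀ i, 0 ≤ coeff i φ) (h' : ∀ i, 0 ≤ coeff i ψ) (n : ℕ) :
    0 ≤ coeff n (φ * ψ) := by
  rw [coeff_mul]
  exact Finset.sum_nonneg (fun p _ => mul_nonneg (h _) (h' _))

open PowerSeries in
lemma one_sub_Pm (ρ : ℝ) (m n : ℕ) : coeff n (AA 1 * (1 - ff ρ ^ m)) = 1 - Pm ρ m n := by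
  rw [mul_sub, map_sub, mul_one, coeff_AA_one]
  have := cc_one n
  rw [cc] at this
  rw [this]; rfl

open PowerSeries in
lemma Pm_le_one {ρ : ℝ} (h0 : 0 ≤ ρ) (h1 : ρ ≤ 1) (m n : ℕ) : Pm ρ m n ≤ 1 := by
  have h := one_sub_Pm ρ m n
  rw [geo, map_sum] at h
  have : 0 ≤ ∑ i ∈ Finset.range m, coeff n (AA (1 - ρ) * ff ρ ^ i) :=
    Finset.sum_nonneg (fun i _ => mul_nonneg_coeff (fun j => cc_nonneg (by linarith) j) (ffp_nonneg h0 h1 i) n)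
  linarith

open PowerSeries in
lemma tail_bound {ρ : ℝ} (h0 : 0 ≤ ρ) (h1 : ρ ≤ 1) (m n : ℕ) :
    (n + 1) * (1 - Pm ρ m n) ≤ m * cc (2 - ρ) n := by
  have h := congrArg (coeff n) (geo ρ 2 m)
  rw [map_sum, show (2:ℝ) = 1 + 1 by norm_num, AA_add, mul_assoc, coeff_AA_one] at h
  calc (n + 1) * (1 - Pm ρ m n) = ∑ j ∈ Finset.range (n+1), (1 - Pm ρ m n) := by
        rw [Finset.sum_const, Finset.card_range, nsmul_eq_mul]; push_cast; ring
    _ ≤ ∑ j ∈ Finset.range (n+1), coeff j (AA 1 * (1 - ff ρ ^ m)) := by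
        apply Finset.sum_le_sum
        intro j hj
        rw [one_sub_Pm]
        have := Pm_mono h0 h1 m (by simp at hj; omega : j ≤ n)
        linarith
    _ = _ := h
    _ ≤ ∑ i ∈ Finset.range m, cc (2 - ρ) n := by
        apply Finset.sum_le_sum
        intro i _
        rw [show (1:ℝ) + 1 = 2 by norm_num, mul_comm, coeff_mul, Finset.Nat.sum_antidiagonal_eq_sum_range_succ_mk]
        have hc : 0 ≤ cc (2 - ρ) n := cc_nonneg (by linarith) n
        calc _ ≤ ∑ j ∈ Finset.range (n+1), coeff j (ff ρ ^ i) * cc (2 - ρ) n := by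
              apply Finset.sum_le_sum
              intro j _
              exact mul_le_mul_of_nonneg_left (cc_mono (by linarith) (Nat.sub_le n j)) (ffp_nonneg h0 h1 i j)
          _ = Pm ρ i n * cc (2 - ρ) n := by rw [← Finset.sum_mul]; rfl
          _ ≤ _ := by nlinarith [Pm_le_one h0 h1 i n]
    _ = _ := by rw [Finset.sum_const, Finset.card_range, nsmul_eq_mul]

open PowerSeries in
lemma AA_deriv (a : ℝ) : derivative ℝ (AA a) = C a * AA (a + 1) := by
  ext n
  rw [coeff_derivative, coeff_C_mul]
  change cc a (n+1) * (n+1) = a * cc (a+1) n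
  rw [cc_succ]
  induction n with
  | zero => simp [cc_zero]
  | succ n ih =>
    rw [cc_succ', cc_succ']
    have : (n:ℝ) + 1 ≠ 0 := by positivity
    push_cast
    field_simp
    linear_combination (a + n + 1) * ih

open PowerSeries in
lemma G_bound {ρ a : ℝ} (h0 : 0 ≤ ρ) (h1 : ρ ≤ 1) (ha : 0 ≤ a) (haρ0 : 0 ≤ a + 1 - ρ) (haρ : a + 1 - ρ ≤ 1) (m n : ℕ) :
    ρ * (m+1) * (cc (a + 1 - ρ) n * Pm ρ m n) ≤ (n + 1) * coeff (n+1) (AA a * ff ρ ^ (m+1)) := by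
  have hd : derivative ℝ (AA a * ff ρ ^ (m+1)) = C a * (AA (a+1) * ff ρ ^ (m+1)) + C (ρ * (m+1)) * (AA (a + 1 - ρ) * ff ρ ^ m) := by
    have h2 : derivative ℝ (ff ρ) = C ρ * AA (1 - ρ) := by
      unfold ff
      rw [map_sub, AA_deriv, map_neg, show -ρ + 1 = 1 - ρ by ring]
      simp
    have h3 : AA (a + 1 - ρ) = AA a * AA (1 - ρ) := by rw [← AA_add]; congr 1; ring
    rw [Derivation.leibniz, Derivation.leibniz_pow, h2, AA_deriv, h3]
    simp only [smul_eq_mul, nsmul_eq_mul, Nat.add_sub_cancel, map_mul, map_add, map_natCast, map_one]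
    push_cast
    ring
  have h := congrArg (coeff n) hd
  rw [coeff_derivative, map_add, coeff_C_mul, coeff_C_mul] at h
  have p1 : 0 ≤ a * coeff n (AA (a+1) * ff ρ ^ (m+1)) :=
    mul_nonneg ha (mul_nonneg_coeff (fun j => cc_nonneg (by linarith) j) (ffp_nonneg h0 h1 _) n)
  have p2 : cc (a + 1 - ρ) n * Pm ρ m n ≤ coeff n (AA (a + 1 - ρ) * ff ρ ^ m) := by
    rw [mul_comm (AA _), coeff_mul, Finset.Nat.sum_antidiagonal_eq_sum_range_succ_mk, Pm, Finset.mul_sum]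
    apply Finset.sum_le_sum
    intro j _
    rw [mul_comm]
    exact mul_le_mul_of_nonneg_left (cc_anti haρ0 haρ (Nat.sub_le n j)) (ffp_nonneg h0 h1 m j)
  have p3 := mul_le_mul_of_nonneg_left p2 (by positivity : 0 ≤ ρ * (m+1))
  linarith

lemma kap_norm_le (η : ℝ) : ‖((1 - Complex.I * η)⁻¹ : ℂ)‖ ≤ 1 := by
  rw [norm_inv]
  apply inv_le_one_of_one_le₀
  have := Complex.abs_re_le_norm (1 - Complex.I * η)
  simpa using this

lemma dd_nonneg (η : ℝ) (m : ℕ) : 0 ≤ dd η m := by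
  unfold dd
  have h1 := Complex.re_le_norm (((1 - Complex.I * η)⁻¹ : ℂ) ^ (m+1))
  rw [norm_pow] at h1
  have h2 := pow_le_one₀ (n := m+1) (norm_nonneg _) (kap_norm_le η)
  linarith

lemma dd_sum (η : ℝ) (hη : 0 < η) (L : ℕ) : L - 2 / η ≤ ∑ i ∈ Finset.range L, dd η (L + 1 + i) := by
  set κ : ℂ := (1 - Complex.I * η)⁻¹ with hκ
  have hk0 : κ ≠ 0 := inv_ne_zero (kap_ne η)
  have hk : κ * (1 - Complex.I * η) = 1 := inv_mul_cancel₀ (kap_ne η)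
  have hg : ∑ i ∈ Finset.range L, κ ^ (L + 1 + i + 1) = κ ^ (L+1) * (κ ^ L - 1) / (Complex.I * η) := by
    have hη' : (Complex.I * η : ℂ) ≠ 0 := mul_ne_zero Complex.I_ne_zero (by exact_mod_cast hη.ne')
    rw [eq_div_iff hη', ← geom_sum_mul]
    have e : ∀ i, κ ^ (L + 1 + i + 1) = κ ^ (L + 2) * κ ^ i := by intro i; ring
    simp only [e]
    rw [← Finset.mul_sum]
    linear_combination (-(κ ^ (L+1)) * (∑ i ∈ Finset.range L, κ ^ i)) * hk
  have hn : ‖∑ i ∈ Finset.range L, κ ^ (L + 1 + i + 1)‖ ≤ 2 / η := by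
    rw [hg, norm_div, norm_mul, norm_mul, Complex.norm_I, one_mul, Complex.norm_real, Real.norm_of_nonneg hη.le]
    have h1 : ‖κ ^ (L+1)‖ ≤ 1 := by rw [norm_pow]; exact pow_le_one₀ (norm_nonneg _) (kap_norm_le η)
    have h2 : ‖κ ^ L - 1‖ ≤ 2 := by
      have h3 : ‖κ ^ L‖ ≤ 1 := by rw [norm_pow]; exact pow_le_one₀ (norm_nonneg _) (kap_norm_le η)
      have := norm_sub_le (κ ^ L) 1
      rw [norm_one] at this
      linarith
    gcongr
    nlinarith [norm_nonneg (κ ^ (L+1)), norm_nonneg (κ ^ L - 1)]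
  have hr := (Complex.re_le_norm _).trans hn
  rw [Complex.re_sum] at hr
  simp only [dd]
  rw [Finset.sum_sub_distrib]
  simp only [Finset.sum_const, Finset.card_range, nsmul_eq_mul, mul_one]
  linarith

open PowerSeries in
lemma pp_lower (α η : ℝ) (hα1 : 1 < α) (hα2 : α ≤ 4 / 3) (hη : 0 < η) (hη1 : η ^ 2 < 1) (n L : ℕ)
    (hP : ∀ m ≤ 2 * L, 1 / 2 ≤ Pm (α/2) m n) :
    (L - 2 / η) * (α/2 * L / (2 * (n+1)) * cc (3 - 2 * α) n) ≤ η ^ 2 * pp α (η ^ 2) (n+1) := by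
  have h1 := congrArg (coeff (n+1)) (pp_subst α η hα1 hα2 hη1)
  rw [coeff_C_mul, coeff_mk] at h1
  have hs : HasSubst (ff (α/2)) := by
    unfold ff
    apply HasSubst.of_constantCoeff_zero'
    rw [← coeff_zero_eq_constantCoeff_apply, map_sub]
    have := cc_zero (-(α/2))
    rw [cc] at this
    simp [this]
  have r0 : 0 ≤ α/2 := by linarith
  have r1 : α/2 ≤ 1 := by linarith
  have hS : ∀ i, ∑ k ∈ Finset.range L, dd η (L + 1 + k) * coeff i (ff (α/2) ^ (L + 1 + k)) ≤ coeff i ((mk (dd η)).subst (ff (α/2))) := by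
    intro i
    have hf := coeff_subst_finite' hs (mk (dd η)) i
    set T : Finset ℕ := Finset.image (fun k => L + 1 + k) (Finset.range L) with hT
    rw [coeff_subst' hs, finsum_eq_sum_of_support_subset (s := hf.toFinset ∪ T) _ (by
      intro x hx; rw [Finset.coe_union]; left; exact hf.mem_toFinset.mpr hx)]
    calc _ = ∑ k ∈ T, dd η k * coeff i (ff (α/2) ^ k) := by
          rw [hT, Finset.sum_image]
          intro x _ y _ h; simp at h; exact h
      _ ≤ ∑ k ∈ hf.toFinset ∪ T, dd η k * coeff i (ff (α/2) ^ k) := by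
          apply Finset.sum_le_sum_of_subset_of_nonneg Finset.subset_union_right
          intro k _ _
          exact mul_nonneg (dd_nonneg η k) (ffp_nonneg r0 r1 k i)
      _ = _ := by simp only [coeff_mk, smul_eq_mul]
  have ha : 0 ≤ 2 - α - α/2 := by linarith
  have h2 : ∑ k ∈ Finset.range L, dd η (L + 1 + k) * coeff (n+1) (AA (2 - α - α/2) * ff (α/2) ^ (L + 1 + k)) ≤ η ^ 2 * pp α (η ^ 2) (n+1) := by
    rw [h1]
    change _ ≤ coeff (n+1) (AA (2 - α - α/2) * (mk (dd η)).subst (ff (α/2)))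
    simp only [coeff_mul, Finset.mul_sum]
    rw [Finset.sum_comm]
    apply Finset.sum_le_sum
    intro p _
    have := mul_le_mul_of_nonneg_left (hS p.2) (cc_nonneg ha p.1)
    rw [Finset.mul_sum] at this
    refine le_trans (le_of_eq ?_) this
    apply Finset.sum_congr rfl
    intro k _
    rw [cc]; ring
  refine le_trans ?_ h2
  have hc : 0 ≤ cc (3 - 2 * α) n := cc_nonneg (by linarith) n
  calc _ ≤ (∑ k ∈ Finset.range L, dd η (L + 1 + k)) * (α/2 * L / (2 * (n+1)) * cc (3 - 2 * α) n) := by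
        apply mul_le_mul_of_nonneg_right (dd_sum η hη L)
        positivity
    _ = ∑ k ∈ Finset.range L, dd η (L + 1 + k) * (α/2 * L / (2 * (n+1)) * cc (3 - 2 * α) n) := by rw [Finset.sum_mul]
    _ ≤ _ := by
      apply Finset.sum_le_sum
      intro k hk
      apply mul_le_mul_of_nonneg_left _ (dd_nonneg η _)
      have hk' : k < L := by simpa using hk
      have hG := G_bound (ρ := α/2) (a := 2 - α - α/2) r0 r1 ha (by linarith) (by linarith) (L + k) n
      rw [show 2 - α - α/2 + 1 - α/2 = 3 - 2 * α by ring, show L + k + 1 = L + 1 + k by ring] at hG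
      have hPk := hP (L + k) (by omega)
      have e : α/2 * L / (2 * (n+1)) * cc (3 - 2 * α) n = (α/2 * L * (cc (3 - 2 * α) n * (1/2))) / (n+1) := by
        field_simp
      rw [e, div_le_iff₀ (by positivity), mul_comm _ ((n:ℝ)+1)]
      refine le_trans ?_ hG
      push_cast
      gcongr
      have : (0:ℝ) ≤ k := by positivity
      linarith

open Filter in
lemma E_large (α : ℝ) (hα1 : 1 < α) (hα2 : α ≤ 4 / 3) :
    ∃ c X : ℝ, 0 < c ∧ 0 < X ∧ ∀ x, X ≤ x → c ≤ x * mittagLeffler α 2 (-x) := by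
  have hG1 : 0 < Real.Gamma (2 - α/2) := Real.Gamma_pos_of_pos (by linarith)
  have hG2 : 0 < Real.Gamma (3 - 2 * α) := Real.Gamma_pos_of_pos (by linarith)
  set B : ℝ := 1 / Real.Gamma (2 - α/2) + 1 with hB
  have hBpos : 0 < B := by positivity
  set ε : ℝ := 1 / (4 * B) with hε
  have hεpos : 0 < ε := by positivity
  have hεB : ε * B = 1 / 4 := by rw [hε]; field_simp
  refine ⟨α/2 * ε^2 / 16 * (1 / Real.Gamma (3 - 2 * α)), (8/ε)^2, by positivity, by positivity, ?_⟩
  intro x hx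
  have hx0 : 0 < x := lt_of_lt_of_le (by positivity) hx
  have hsx : 8 / ε ≤ √x := Real.le_sqrt_of_sq_le hx
  have hsx0 : 0 < √x := Real.sqrt_pos.mpr hx0
  have t1 := (pp_tendsto α x hα1 hα2 hx0).const_mul x
  have t2 := (cc_tendsto (3 - 2 * α) (by linarith)).const_mul (α/2 * ε^2 / 16)
  rw [← tendsto_add_atTop_iff_nat 1] at t1 t2
  refine le_of_tendsto_of_tendsto t2 t1 ?_
  have e1 := (cc_tendsto (2 - α/2) (by linarith)).eventually_le_const (u := B) (by rw [hB]; linarith)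
  have e1' := (tendsto_add_atTop_nat 1).eventually e1
  have hs : Tendsto (fun n : ℕ => ((n+1 : ℕ):ℝ) ^ (α/2)) atTop atTop :=
    (tendsto_rpow_atTop (by linarith)).comp (tendsto_natCast_atTop_atTop.comp (tendsto_add_atTop_nat 1))
  filter_upwards [e1', hs.eventually_ge_atTop (2/ε), hs.eventually_gt_atTop (√x)] with n h1 h2 h3
  set N : ℝ := ((n+1 : ℕ):ℝ) with hN
  have hNn : N = n + 1 := by rw [hN]; push_cast; ring
  have hN0 : 0 < N := by rw [hNn]; positivity
  set s : ℝ := N ^ (α/2) with hsdef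
  have hs0 : 0 < s := by positivity
  set η : ℝ := √x / s with hη
  have hη0 : 0 < η := by positivity
  have hs2 : s ^ 2 = N ^ α := by
    rw [hsdef, ← Real.rpow_natCast, ← Real.rpow_mul hN0.le]; congr 1; push_cast; ring
  have hη2 : η ^ 2 = x * N ^ (-α) := by
    rw [hη, div_pow, Real.sq_sqrt hx0.le, hs2, Real.rpow_neg hN0.le]; rfl
  have hη1 : η < 1 := by rw [hη, div_lt_one hs0]; exact h3
  set L : ℕ := ⌊ε * s⌋₊ with hL
  have hL1 : (L:ℝ) ≤ ε * s := Nat.floor_le (by positivity)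
  have hL2 : ε * s / 2 ≤ L := by
    have := Nat.lt_floor_add_one (ε * s)
    rw [div_le_iff₀ hεpos] at h2
    have h4 : ε * s < L + 1 := this
    linarith
  have hP : ∀ m ≤ 2 * L, 1 / 2 ≤ Pm (α/2) m n := by
    intro m hm
    have ht := tail_bound (ρ := α/2) (by linarith) (by linarith) m n
    have hcm : cc (2 - α/2) n ≤ cc (2 - α/2) (n+1) := cc_mono (by linarith) (Nat.le_succ n)
    have hm' : (m:ℝ) ≤ 2 * (ε * s) := by
      have : (m:ℝ) ≤ 2 * L := by exact_mod_cast hm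
      linarith
    have hc : cc (2 - α/2) (n+1) ≤ B * (N / s) := by
      have e : N / s = (N ^ (1 - (2 - α/2)))⁻¹ := by
        rw [← Real.rpow_neg hN0.le, hsdef, show -(1 - (2 - α/2)) = 1 - α/2 by ring, Real.rpow_sub hN0, Real.rpow_one]
      rw [e, ← div_eq_mul_inv, le_div_iff₀ (by positivity), mul_comm]
      exact h1
    have h5 : (m:ℝ) * cc (2 - α/2) n ≤ 2 * (ε * s) * (B * (N / s)) :=
      mul_le_mul hm' (hcm.trans hc) (cc_nonneg (by linarith) n) (by positivity)
    have h6 : 2 * (ε * s) * (B * (N / s)) = N / 2 := by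
      calc _ = 2 * (ε * B) * N := by field_simp
        _ = _ := by rw [hεB]; ring
    rw [h6, ] at h5
    rw [← hNn] at ht
    have h7 := ht.trans h5
    have : 1 - Pm (α/2) m n ≤ 1 / 2 := by
      apply le_of_mul_le_mul_left _ hN0
      linarith
    linarith
  have key := pp_lower α η hα1 hα2 hη0 (by nlinarith) n L hP
  rw [hη2, ← hNn] at key
  have hc2 : cc (3 - 2 * α) (n+1) ≤ cc (3 - 2 * α) n := cc_anti (by linarith) (by linarith) (Nat.le_succ n)
  have hc0 : 0 ≤ cc (3 - 2 * α) (n+1) := cc_nonneg (by linarith) _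
  have h8 : ε * s / 4 ≤ L - 2 / η := by
    have : 2 / η ≤ ε * s / 4 := by
      rw [hη, div_div_eq_mul_div, div_le_iff₀ hsx0]
      rw [div_le_iff₀ hεpos] at hsx
      nlinarith
    linarith
  have h9 : (ε * s / 4) * (α/2 * (ε * s / 2) / (2 * N) * cc (3 - 2 * α) (n+1)) ≤ x * N ^ (-α) * pp α (x * N ^ (-α)) (n+1) := by
    refine le_trans ?_ key
    have h10 : α/2 * (ε * s / 2) / (2 * N) * cc (3 - 2 * α) (n+1) ≤ α/2 * L / (2 * N) * cc (3 - 2 * α) n := by gcongr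
    exact mul_le_mul h8 h10 (by positivity) (le_trans (by positivity) h8)
  have h11 := mul_le_mul_of_nonneg_left h9 (by positivity : 0 ≤ N ^ (α - 1))
  have e3 : N ^ (1 - (3 - 2 * α)) = N ^ (α - 1) * (s ^ 2 / N) := by
    rw [hs2, show 1 - (3 - 2 * α) = (α - 1) + (α - 1) by ring, Real.rpow_add hN0]
    congr 1
    rw [Real.rpow_sub hN0, Real.rpow_one]
  have e4 : N⁻¹ = N ^ (α - 1) * N ^ (-α) := by
    rw [← Real.rpow_add hN0, show α - 1 + -α = -1 by ring, Real.rpow_neg_one]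
  rw [e3, e4]
  refine le_trans (le_of_eq ?_) (h11.trans (le_of_eq ?_))
  · field_simp; ring
  · ring

open Filter in
lemma E_quad (α x : ℝ) (hα1 : 1 < α) (hα2 : α ≤ 4 / 3) (hx : 0 < x) :
    mittagLeffler α 2 (-(4 * x)) ≤ mittagLeffler α 2 (-x) := by
  refine le_of_tendsto_of_tendsto (pp_tendsto α (4 * x) hα1 hα2 (by linarith)) (pp_tendsto α x hα1 hα2 hx) ?_
  have hs : Tendsto (fun n : ℕ => (n:ℝ) ^ (α/2)) atTop atTop :=
    (tendsto_rpow_atTop (by linarith)).comp tendsto_natCast_atTop_atTop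
  filter_upwards [hs.eventually_gt_atTop (2 * √x), eventually_gt_atTop 0] with n h3 hn
  have hN0 : (0:ℝ) < n := by exact_mod_cast hn
  have hsx0 : 0 < √x := Real.sqrt_pos.mpr hx
  set N : ℝ := (n:ℝ)
  set s : ℝ := N ^ (α/2) with hsdef
  have hs0 : 0 < s := by positivity
  have hs2 : s ^ 2 = N ^ α := by
    rw [hsdef, ← Real.rpow_natCast, ← Real.rpow_mul hN0.le]; congr 1; push_cast; ring
  have hη2 : (√x / s) ^ 2 = x * N ^ (-α) := by
    rw [div_pow, Real.sq_sqrt hx.le, hs2, Real.rpow_neg hN0.le]; rfl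
  have hη1 : 2 * (√x / s) < 1 := by rw [← mul_div_assoc, div_lt_one hs0]; exact h3
  have h := pp_double α (√x / s) hα1 hα2 (by positivity) (by
    have : 0 < 2 * (√x / s) := by positivity
    nlinarith) n
  rw [hη2, ← mul_assoc] at h
  exact mul_le_mul_of_nonneg_left h (by positivity)

lemma E_lower (α : ℝ) (hα1 : 1 < α) (hα2 : α ≤ 4 / 3) :
    ∃ c : ℝ, 0 < c ∧ ∀ x, 1 ≤ x → c ≤ x * mittagLeffler α 2 (-x) := by
  obtain ⟨c, X, hc, hX, h⟩ := E_large α hα1 hα2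
  obtain ⟨k, hk⟩ := pow_unbounded_of_one_lt X (by norm_num : (1:ℝ) < 4)
  refine ⟨c / 4 ^ k, by positivity, ?_⟩
  intro x hx
  have hm : ∀ j : ℕ, mittagLeffler α 2 (-(4 ^ j * x)) ≤ mittagLeffler α 2 (-x) := by
    intro j
    induction j with
    | zero => simp
    | succ j ih =>
      have := E_quad α (4 ^ j * x) hα1 hα2 (by positivity)
      rw [← mul_assoc, ← pow_succ'] at this
      exact this.trans ih
  have h4 : (0:ℝ) < 4 ^ k := by positivity
  have h1 := h (4 ^ k * x) (by nlinarith)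
  rw [div_le_iff₀ h4]
  have := mul_le_mul_of_nonneg_left (hm k) (by positivity : 0 ≤ 4 ^ k * x)
  linarith

lemma interp (θ : ℝ) (h0 : 0 ≤ θ) (h1 : θ < 1) (u w : ℕ → ℝ) (hu : ∀ n, 0 ≤ u n) (hw : ∀ n, 0 ≤ w n)
    (su : Summable u) (sw : Summable w) :
    Summable (fun n => u n ^ θ * w n ^ (1 - θ)) ∧
    ∑' n, u n ^ θ * w n ^ (1 - θ) ≤ (∑' n, u n) ^ θ * (∑' n, w n) ^ (1 - θ) := by
  rcases h0.eq_or_lt with h | h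
  · subst h
    simpa using sw
  · have hc : (θ⁻¹).HolderConjugate (1 - θ)⁻¹ := Real.HolderConjugate.inv_inv h (by linarith) (by ring)
    have e1 : ∀ n, (u n ^ θ) ^ θ⁻¹ = u n := fun n => Real.rpow_rpow_inv (hu n) h.ne'
    have e2 : ∀ n, (w n ^ (1 - θ)) ^ (1 - θ)⁻¹ = w n := fun n => Real.rpow_rpow_inv (hw n) (by linarith)
    have := Real.summable_and_inner_le_Lp_mul_Lq_tsum_of_nonneg hc (f := fun n => u n ^ θ) (g := fun n => w n ^ (1 - θ))
      (fun n => Real.rpow_nonneg (hu n) _) (fun n => Real.rpow_nonneg (hw n) _) (by simpa only [e1] using su) (by simpa only [e2] using sw)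
    simpa only [e1, e2, one_div, inv_inv] using this

/-- conditional stability (Theorem 3.2, case `α ∈ (1,4/3]`) in Fourier
coefficients: there is `C > 0` (depending only on `α, β, γ, T`) such that for every
nondecreasing positive sequence `λ` with `λ_0 T^α ≥ 1`, every `M > 0` and every
sequence `a` with `∑ λ_n^{2β} a_n² ≤ M²`, if `b_n = T E_{α,2}(−λ_n T^α) a_n` and
`∑ b_n²` converges, then `∑ λ_n^{−2γ} a_n² ≤ C M^{2(1−γ)/(1+β)} (∑ b_n²)^{(β+γ)/(1+β)}`. -/
theorem conditional_stability (α β γ T : ℝ) (hα1 : 1 < α) (hα2 : α ≤ 4 / 3)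
    (hβ0 : 0 ≤ β) (hβ1 : β ≤ 1) (hγ0 : 0 ≤ γ) (hγ1 : γ ≤ 1) (hβγ : 0 < β + γ)
    (hT : 0 < T) :
    ∃ C : ℝ, 0 < C ∧
      ∀ lam : ℕ → ℝ, Monotone lam → (∀ n, 0 < lam n) → 1 ≤ lam 0 * T ^ α →
      ∀ M : ℝ, 0 < M → ∀ a : ℕ → ℝ,
      (Summable fun n => lam n ^ (2 * β) * a n ^ 2) →
      (∑' n, lam n ^ (2 * β) * a n ^ 2) ≤ M ^ 2 →
      (Summable fun n => (T * mittagLeffler α 2 (-(lam n * T ^ α)) * a n) ^ 2) →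
      Summable (fun n => lam n ^ (-(2 * γ)) * a n ^ 2) ∧
      (∑' n, lam n ^ (-(2 * γ)) * a n ^ 2) ≤
        C * M ^ (2 * (1 - γ) / (1 + β)) *
          (∑' n, (T * mittagLeffler α 2 (-(lam n * T ^ α)) * a n) ^ 2) ^ ((β + γ) / (1 + β)) := by
  obtain ⟨c, hc, hE⟩ := E_lower α hα1 hα2
  set d : ℝ := T * c / T ^ α with hd
  have hTα : 0 < T ^ α := Real.rpow_pos_of_pos hT α
  have hd0 : 0 < d := by positivity
  have hb1 : 0 < 1 + β := by linarith
  set θ : ℝ := (1 - γ) / (1 + β) with hθ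
  have hθ1 : 1 - θ = (β + γ) / (1 + β) := by rw [hθ]; field_simp; ring
  have hθpos : 0 < 1 - θ := by rw [hθ1]; positivity
  have hθ0 : 0 ≤ θ := div_nonneg (by linarith) hb1.le
  refine ⟨((d ^ 2)⁻¹) ^ (1 - θ), by positivity, ?_⟩
  intro lam hmono hpos hlam0 M hM a hsa hsM hsb
  have key : ∀ n, lam n ^ (-2 : ℝ) * a n ^ 2 ≤ (d ^ 2)⁻¹ * (T * mittagLeffler α 2 (-(lam n * T ^ α)) * a n) ^ 2 := by
    intro n
    have hl := hpos n
    have hx : 1 ≤ lam n * T ^ α :=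
      hlam0.trans (mul_le_mul_of_nonneg_right (hmono (Nat.zero_le n)) hTα.le)
    have h1 := hE _ hx
    set E := mittagLeffler α 2 (-(lam n * T ^ α))
    have h2 : d ≤ lam n * (T * E) := by
      rw [hd, div_le_iff₀ hTα]
      nlinarith
    have h3 : d ^ 2 ≤ (lam n * (T * E)) ^ 2 := by gcongr
    rw [Real.rpow_neg hl.le, show (2:ℝ) = ((2:ℕ):ℝ) by norm_num, Real.rpow_natCast,
      inv_mul_le_iff₀ (by positivity), ← mul_assoc, mul_comm (lam n ^ 2), mul_assoc, ← div_eq_inv_mul,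
      le_div_iff₀ (by positivity)]
    calc a n ^ 2 * d ^ 2 ≤ a n ^ 2 * (lam n * (T * E)) ^ 2 := by gcongr
      _ = _ := by ring
  have hw0 : ∀ n, 0 ≤ lam n ^ (-2 : ℝ) * a n ^ 2 := fun n =>
    mul_nonneg (Real.rpow_nonneg (hpos n).le _) (sq_nonneg _)
  have hu0 : ∀ n, 0 ≤ lam n ^ (2 * β) * a n ^ 2 := fun n =>
    mul_nonneg (Real.rpow_nonneg (hpos n).le _) (sq_nonneg _)
  have hsw : Summable fun n => lam n ^ (-2 : ℝ) * a n ^ 2 :=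
    Summable.of_nonneg_of_le hw0 key (hsb.mul_left _)
  have hW : ∑' n, lam n ^ (-2 : ℝ) * a n ^ 2 ≤ (d ^ 2)⁻¹ * ∑' n, (T * mittagLeffler α 2 (-(lam n * T ^ α)) * a n) ^ 2 := by
    rw [← tsum_mul_left]
    exact hsw.tsum_le_tsum key (hsb.mul_left _)
  obtain ⟨hs, hle⟩ := interp θ hθ0 (by linarith) _ _ hu0 hw0 hsa hsw
  have e : ∀ n, (lam n ^ (2 * β) * a n ^ 2) ^ θ * (lam n ^ (-2 : ℝ) * a n ^ 2) ^ (1 - θ) = lam n ^ (-(2 * γ)) * a n ^ 2 := by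
    intro n
    have hl := hpos n
    rw [Real.mul_rpow (by positivity) (by positivity), Real.mul_rpow (by positivity) (by positivity),
      ← Real.rpow_mul hl.le, ← Real.rpow_mul hl.le]
    have e1 : (a n ^ 2) ^ θ * (a n ^ 2) ^ (1 - θ) = a n ^ 2 := by
      rcases eq_or_ne (a n) 0 with h0 | h0
      · rw [h0]; simp [Real.zero_rpow hθpos.ne']
      · rw [← Real.rpow_add (by positivity)]; simp
    have e2 : lam n ^ (2 * β * θ) * lam n ^ (-2 * (1 - θ)) = lam n ^ (-(2 * γ)) := by
      rw [← Real.rpow_add hl]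
      congr 1
      rw [hθ]; field_simp; ring
    rw [← e2]
    nth_rewrite 3 [← e1]
    ring
  simp only [e] at hs hle
  refine ⟨hs, hle.trans ?_⟩
  have hB0 : 0 ≤ ∑' n, (T * mittagLeffler α 2 (-(lam n * T ^ α)) * a n) ^ 2 := tsum_nonneg (fun n => sq_nonneg _)
  have f1 : (∑' n, lam n ^ (2 * β) * a n ^ 2) ^ θ ≤ M ^ (2 * (1 - γ) / (1 + β)) := by
    have : M ^ (2 * (1 - γ) / (1 + β)) = (M ^ 2) ^ θ := by
      rw [← Real.rpow_natCast, ← Real.rpow_mul hM.le, hθ]; congr 1; push_cast; ring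
    rw [this]
    exact Real.rpow_le_rpow (tsum_nonneg hu0) hsM hθ0
  have f2 := Real.rpow_le_rpow (tsum_nonneg hw0) hW hθpos.le
  rw [Real.mul_rpow (by positivity) hB0] at f2
  rw [← hθ1]
  calc _ ≤ M ^ (2 * (1 - γ) / (1 + β)) * (((d ^ 2)⁻¹) ^ (1 - θ) * (∑' n, (T * mittagLeffler α 2 (-(lam n * T ^ α)) * a n) ^ 2) ^ (1 - θ)) :=
        mul_le_mul f1 f2 (Real.rpow_nonneg (tsum_nonneg hw0) _) (by positivity)
    _ = _ := by ring
end

section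
/- Let 4/3 < α < 2, let β ∈ [0,1] and γ ∈ [0,1] with β + γ > 0, let T > 0, and let λ : ℕ → ℝ be a nondecreasing sequence of positive numbers with λ_n → ∞ such that E_{α,2}(−λ_n T^α) ≠ 0 for every n. Then there exists a constant C_T > 0 (depending on α, β, γ, T and the sequence λ) such that for every M > 0 and every sequence a : ℕ → ℝ with ∑_n λ_n^{2β} a_n² ≤ M², if b_n := T · E_{α,2}(−λ_n T^α) · a_n and ∑_n b_n² converges, then ∑_n λ_n^{−2γ} a_n² ≤ C_T · M^{2(1−γ)/(1+β)} · (∑_n b_n²)^{(β+γ)/(1+β)}. -/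
section MLaux

open MeasureTheory Set

lemma ML_intg {e b : ℝ} (he : -1 < e) (hb : 0 < b) :
    IntegrableOn (fun t : ℝ => t ^ e * Real.exp (-b * t)) (Ioi 0) := by
  have := integrableOn_rpow_mul_exp_neg_mul_rpow he one_pos hb
  simpa using this

lemma ML_norm {e t : ℝ} (s : ℂ) (ht : 0 < t) :
    ‖((t ^ e : ℝ) : ℂ) * Complex.exp (-(s * t))‖ = t ^ e * Real.exp (-s.re * t) := by
  rw [norm_mul, Complex.norm_exp, Complex.norm_real, Real.norm_of_nonneg (by positivity)]
  simp

lemma ML_meas (e : ℝ) (s : ℂ) :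
    AEStronglyMeasurable (fun t : ℝ => ((t ^ e : ℝ) : ℂ) * Complex.exp (-(s * t)))
      (volume.restrict (Ioi 0)) := by
  apply Measurable.aestronglyMeasurable
  fun_prop

lemma ML_intC {e : ℝ} {s : ℂ} (he : -1 < e) (hs : 0 < s.re) :
    IntegrableOn (fun t : ℝ => ((t ^ e : ℝ) : ℂ) * Complex.exp (-(s * t))) (Ioi 0) := by
  refine Integrable.mono' (ML_intg he hs) (ML_meas e s) ?_
  filter_upwards [ae_restrict_mem measurableSet_Ioi] with t ht
  exact (ML_norm s ht).le

lemma ML_deriv {w : ℝ} (hw : 0 < w) {s : ℂ} (hs : 0 < s.re) :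
    HasDerivAt (fun z : ℂ => ∫ t in Ioi (0:ℝ), ((t ^ (w - 1) : ℝ) : ℂ) * Complex.exp (-(z * t)))
      (∫ t in Ioi (0:ℝ), ((t ^ (w - 1) : ℝ) : ℂ) * (Complex.exp (-(s * t)) * (-t))) s := by
  have hb : 0 < s.re / 2 := by positivity
  refine (hasDerivAt_integral_of_dominated_loc_of_deriv_le (s := Metric.ball s (s.re/2))
    (F := fun z (t:ℝ) => ((t ^ (w - 1) : ℝ) : ℂ) * Complex.exp (-(z * t)))
    (F' := fun z (t:ℝ) => ((t ^ (w - 1) : ℝ) : ℂ) * (Complex.exp (-(z * t)) * (-t)))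
    (bound := fun t => t ^ w * Real.exp (-(s.re/2) * t)) (Metric.ball_mem_nhds _ hb) ?_ ?_ ?_ ?_ ?_ ?_).2
  · exact Filter.Eventually.of_forall fun z => ML_meas _ _
  · exact ML_intC (by linarith) hs
  · apply Measurable.aestronglyMeasurable
    fun_prop
  · filter_upwards [ae_restrict_mem measurableSet_Ioi] with t ht z hz
    have ht' : (0:ℝ) < t := ht
    rw [← mul_assoc, norm_mul, ML_norm z ht, norm_neg, Complex.norm_real, Real.norm_of_nonneg ht'.le]
    have h1 : t ^ w = t ^ (w-1) * t := by
      rw [← Real.rpow_add_one ht'.ne']; ring_nf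
    have h2 : s.re / 2 ≤ z.re := by
      have := (Complex.abs_re_le_norm (z - s)).trans (by simpa [dist_eq_norm] using (Metric.mem_ball.1 hz).le)
      have := abs_le.1 this
      simp at this
      linarith
    have h3 : Real.exp (-z.re * t) ≤ Real.exp (-(s.re/2) * t) := by
      apply Real.exp_le_exp.2; nlinarith
    rw [h1, mul_right_comm]
    gcongr
  · exact ML_intg (by linarith) hb
  · refine Filter.Eventually.of_forall fun t z _ => ?_
    have : HasDerivAt (fun z : ℂ => -(z * (t:ℂ))) (-(t:ℂ)) z := by
      have h := ((hasDerivAt_id' z).mul_const (t:ℂ)).fun_neg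
      rwa [one_mul] at h
    exact (this.cexp).const_mul _

lemma ML_laplace {w : ℝ} (hw : 0 < w) {s : ℂ} (hs : 0 < s.re) :
    ∫ t in Ioi (0:ℝ), ((t ^ (w - 1) : ℝ) : ℂ) * Complex.exp (-(s * t)) =
      s ^ (-(w:ℂ)) * Real.Gamma w := by
  have hopen : IsOpen {z : ℂ | 0 < z.re} := isOpen_lt continuous_const Complex.continuous_re
  have hf : AnalyticOnNhd ℂ (fun z : ℂ => ∫ t in Ioi (0:ℝ), ((t ^ (w - 1) : ℝ) : ℂ) * Complex.exp (-(z * t)))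
      {z : ℂ | 0 < z.re} :=
    DifferentiableOn.analyticOnNhd (fun z hz => (ML_deriv hw hz).differentiableAt.differentiableWithinAt) hopen
  have hg : AnalyticOnNhd ℂ (fun z : ℂ => z ^ (-(w:ℂ)) * (Real.Gamma w : ℂ)) {z : ℂ | 0 < z.re} := by
    refine DifferentiableOn.analyticOnNhd (fun z hz => ?_) hopen
    refine (DifferentiableAt.mul_const ?_ _).differentiableWithinAt
    exact (differentiableAt_id).cpow_const (Or.inl hz)
  have hpc : IsPreconnected {z : ℂ | 0 < z.re} := (convex_halfSpace_re_gt 0).isPreconnected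
  refine hf.eqOn_of_preconnected_of_frequently_eq hg hpc (z₀ := 1) (by simp) ?_ hs
  have ht : Filter.Tendsto (fun n : ℕ => (((1 + 1 / ((n:ℝ) + 1) : ℝ)) : ℂ)) Filter.atTop (nhdsWithin 1 {1}ᶜ) := by
    refine tendsto_nhdsWithin_iff.2 ⟨?_, ?_⟩
    · have := (tendsto_one_div_add_atTop_nhds_zero_nat (𝕜 := ℝ)).const_add 1
      simp only [add_zero] at this
      exact_mod_cast (Complex.continuous_ofReal.tendsto _).comp this
    · refine Filter.Eventually.of_forall fun n => ?_
      simp only [mem_compl_iff, mem_singleton_iff]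
      have : (1 + 1 / ((n:ℝ) + 1) : ℝ) ≠ 1 := by
        have : 0 < 1 / ((n:ℝ) + 1) := by positivity
        linarith
      exact_mod_cast this
  refine ht.frequently (Filter.Frequently.of_forall fun n => ?_)
  set r : ℝ := 1 + 1 / ((n:ℝ) + 1) with hr
  have hr0 : 0 < r := by positivity
  have := Complex.integral_cpow_mul_exp_neg_mul_Ioi (a := (w:ℂ)) (by simpa using hw) hr0
  rw [Complex.cpow_neg, ← Complex.inv_cpow _ _ (by rw [Complex.arg_ofReal_of_nonneg hr0.le]; exact Real.pi_pos.ne), ← Complex.Gamma_ofReal, ← one_div, ← this]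
  refine setIntegral_congr_fun measurableSet_Ioi fun t ht => ?_
  rw [Complex.ofReal_cpow (le_of_lt ht)]
  push_cast
  rfl

lemma ML_lineNorm (ξ : ℝ) : (1 + ‖ξ‖) / 2 ≤ ‖(2:ℂ) + ξ * Complex.I‖ := by
  have h1 := Complex.abs_re_le_norm ((2:ℂ) + ξ * Complex.I)
  have h2 := Complex.abs_im_le_norm ((2:ℂ) + ξ * Complex.I)
  simp at h1 h2
  rw [Real.norm_eq_abs]
  linarith

lemma ML_lineInt {w : ℝ} (hw : 1 < w) :
    Integrable (fun ξ : ℝ => ((2:ℂ) + ξ * Complex.I) ^ (-(w:ℂ))) := by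
  have h := (integrable_one_add_norm (E := ℝ) (μ := volume) (r := w) (by simpa using hw)).const_mul ((1/2)^(-w))
  refine h.mono' ?_ ?_
  · apply Continuous.aestronglyMeasurable
    refine continuous_iff_continuousAt.2 fun ξ => ?_
    refine ContinuousAt.cpow (by fun_prop) (by fun_prop) ?_
    left; simp
  · refine Filter.Eventually.of_forall fun ξ => ?_
    have h2 := ML_lineNorm ξ
    have h3 : 0 < (1 + ‖ξ‖)/2 := by positivity
    have : -(w:ℂ) = ((-w : ℝ) : ℂ) := by push_cast; rfl
    rw [this, Complex.norm_cpow_real, ← Real.mul_rpow (by norm_num) (by positivity)]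
    apply Real.rpow_le_rpow_of_nonpos (by positivity) (by linarith) (by linarith)

open FourierTransform in
lemma ML_inv {w t : ℝ} (hw : 1 < w) (ht : 0 < t) :
    ∫ ξ : ℝ, Complex.exp (((2:ℂ) + ξ * Complex.I) * t) * ((2:ℂ) + ξ * Complex.I) ^ (-(w:ℂ)) =
      2 * Real.pi * (t ^ (w - 1) / Real.Gamma w : ℝ) := by
  have hG : 0 < Real.Gamma w := Real.Gamma_pos_of_pos (by linarith)
  set f : ℝ → ℂ := fun x => (((max x 0) ^ (w - 1) : ℝ) : ℂ) * Complex.exp (-(2 * x)) with hf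
  have hfz : ∀ x, x ≤ 0 → f x = 0 := by
    intro x hx
    simp only [hf]
    rw [max_eq_right hx, Real.zero_rpow (by linarith)]; simp
  have hfp : ∀ x, 0 < x → f x = ((x ^ (w - 1) : ℝ) : ℂ) * Complex.exp (-(2 * x)) := by
    intro x hx
    simp only [hf]
    rw [max_eq_left hx.le]
  have hfind : f = (Ioi 0).indicator (fun x : ℝ => ((x ^ (w - 1) : ℝ) : ℂ) * Complex.exp (-(2 * x))) := by
    ext x
    by_cases hx : 0 < x
    · rw [indicator_of_mem (by exact hx), hfp x hx]
    · rw [indicator_of_notMem (by exact hx), hfz x (not_lt.1 hx)]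
  have hc : Continuous f := by
    apply Continuous.mul
    · apply Complex.continuous_ofReal.comp
      apply Continuous.rpow_const (by fun_prop)
      intro x; right; linarith
    · fun_prop
  have hi : Integrable f := by
    rw [hfind, integrable_indicator_iff measurableSet_Ioi]
    exact ML_intC (by linarith) (by simp)
  have hF : ∀ ξ : ℝ, 𝓕 f ξ = ((2:ℂ) + ((2 * Real.pi) * ξ : ℝ) * Complex.I) ^ (-(w:ℂ)) * Real.Gamma w := by
    intro ξ
    rw [Real.fourier_real_eq_integral_exp_smul, ← ML_laplace (by linarith) (by simp),
      ← integral_indicator measurableSet_Ioi]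
    congr 1
    ext x
    rw [hfind]
    by_cases hx : x ∈ Ioi (0:ℝ)
    · rw [indicator_of_mem hx, indicator_of_mem hx, smul_eq_mul, mul_left_comm, ← Complex.exp_add]
      congr 2
      push_cast; ring
    · rw [indicator_of_notMem hx, indicator_of_notMem hx, smul_zero]
  have h2pi : (0:ℝ) < 2 * Real.pi := by positivity
  have hFi : Integrable (𝓕 f) := by
    have : 𝓕 f = fun ξ => ((2:ℂ) + ((2 * Real.pi) * ξ : ℝ) * Complex.I) ^ (-(w:ℂ)) * Real.Gamma w := funext hF
    rw [this]
    exact ((ML_lineInt hw).comp_mul_left' h2pi.ne').mul_const _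
  have key := congrFun (hc.fourierInv_fourier_eq hi hFi) t
  rw [Real.fourierInv_eq', hfp t ht] at key
  have hsub := Measure.integral_comp_mul_left (fun ξ : ℝ => Complex.exp (((2:ℂ) + ξ * Complex.I) * t) * ((2:ℂ) + ξ * Complex.I) ^ (-(w:ℂ))) (2 * Real.pi)
  have h3 : ∀ v : ℝ, Complex.exp (((2 * Real.pi * inner ℝ v t : ℝ) : ℂ) * Complex.I) • 𝓕 f v =
      (Complex.exp (((2:ℂ) + ((2 * Real.pi) * v : ℝ) * Complex.I) * t) * ((2:ℂ) + ((2 * Real.pi) * v : ℝ) * Complex.I) ^ (-(w:ℂ))) * (Real.Gamma w * Complex.exp (-(2 * t))) := by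
    intro v
    rw [hF, smul_eq_mul]
    have : Complex.exp (((2:ℂ) + ((2 * Real.pi) * v : ℝ) * Complex.I) * t) * Complex.exp (-(2 * t)) = Complex.exp (((2 * Real.pi * inner ℝ v t : ℝ) : ℂ) * Complex.I) := by
      rw [← Complex.exp_add]
      congr 1
      simp
      ring
    rw [← this]; ring
  simp_rw [h3] at key
  rw [integral_mul_const, hsub, abs_of_pos (by positivity)] at key
  have hE := Complex.exp_ne_zero (-(2 * (t:ℂ)))
  have hGc : ((Real.Gamma w : ℝ) : ℂ) ≠ 0 := by exact_mod_cast hG.ne'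
  rw [← mul_assoc] at key
  have key2 := mul_right_cancel₀ hE key
  rw [Complex.real_smul] at key2
  have hpic : ((2 * Real.pi : ℝ) : ℂ) ≠ 0 := by exact_mod_cast h2pi.ne'
  rw [Complex.ofReal_div, ← key2]
  push_cast at hpic ⊢
  have hpi : (Real.pi : ℂ) ≠ 0 := by exact_mod_cast Real.pi_ne_zero
  generalize (∫ y : ℝ, Complex.exp (((2:ℂ) + y * Complex.I) * t) * ((2:ℂ) + y * Complex.I) ^ (-(w:ℂ))) = J
  field_simp

noncomputable def mlS (α : ℝ) (s : ℂ) : ℂ :=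
  (s ^ 3)⁻¹ * (s ^ (α:ℂ) * (2 * s ^ (α:ℂ) + (2 - α))) / (1 + s ^ (α:ℂ)) ^ 2

noncomputable def mlG (α : ℝ) (s : ℂ) : ℂ :=
  (s ^ 3)⁻¹ * ((s ^ (α:ℂ)) ^ 2 * ((2 * α - 2) + (α - 2) * s ^ (α:ℂ))) / (1 + s ^ (α:ℂ)) ^ 2

lemma ML_one_add {α : ℝ} (h1 : 1 < α) (h2 : α < 2) {s : ℂ} (hs : 0 < s.re) :
    (1 + Real.cos (α * (Real.pi / 2))) / 2 * (1 + ‖s‖ ^ α) ^ 2 ≤ ‖1 + s ^ (α:ℂ)‖ ^ 2 := by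
  have hpi := Real.pi_pos
  have hs0 : s ≠ 0 := by rintro rfl; simp at hs
  have hn : ‖s ^ (α:ℂ)‖ = ‖s‖ ^ α := Complex.norm_cpow_real s α
  have hre : (s ^ (α:ℂ)).re = ‖s‖ ^ α * Real.cos (s.arg * α) := by
    rw [← hn, Complex.cpow_def_of_ne_zero hs0, Complex.exp_re, Complex.norm_exp]
    congr 2
    simp [Complex.log_im]
  have harg : |s.arg| ≤ Real.pi / 2 := Complex.abs_arg_le_pi_div_two_iff.2 hs.le
  have hcos : Real.cos (α * (Real.pi/2)) ≤ Real.cos (s.arg * α) := by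
    rw [← Real.cos_abs (s.arg * α), abs_mul, abs_of_pos (by linarith : 0 < α), mul_comm]
    apply Real.cos_le_cos_of_nonneg_of_le_pi (by positivity) (by nlinarith)
    gcongr
  have h3 : ‖1 + s ^ (α:ℂ)‖ ^ 2 = 1 + 2 * (s ^ (α:ℂ)).re + (‖s‖ ^ α)^2 := by
    rw [← hn, Complex.sq_norm, Complex.sq_norm, Complex.normSq_apply, Complex.normSq_apply]
    simp; ring
  rw [h3, hre]
  have hr : 0 ≤ ‖s‖ ^ α := by positivity
  set r := ‖s‖ ^ α
  have hc1 := Real.neg_one_le_cos (α * (Real.pi/2))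
  have hc2 := Real.cos_le_one (α * (Real.pi/2))
  set q := Real.cos (α * (Real.pi/2))
  have h5 := mul_le_mul_of_nonneg_left hcos hr
  nlinarith [mul_nonneg (by linarith : 0 ≤ 1 - q) (sq_nonneg (1 - r))]

lemma ML_kappa {α : ℝ} (h1 : 1 < α) (h2 : α < 2) : 0 < (1 + Real.cos (α * (Real.pi / 2))) / 2 := by
  have hpi := Real.pi_pos
  have : Real.cos Real.pi < Real.cos (α * (Real.pi/2)) :=
    Real.cos_lt_cos_of_nonneg_of_le_pi (by positivity) le_rfl (by nlinarith)
  rw [Real.cos_pi] at this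
  linarith

lemma ML_one_add_ne {α : ℝ} (h1 : 1 < α) (h2 : α < 2) {s : ℂ} (hs : 0 < s.re) :
    1 + s ^ (α:ℂ) ≠ 0 := by
  intro h
  have := ML_one_add h1 h2 hs
  rw [h] at this
  have h3 := ML_kappa h1 h2
  have : 0 < (1 + Real.cos (α * (Real.pi / 2))) / 2 * (1 + ‖s‖ ^ α) ^ 2 := by positivity
  simp at *
  linarith

lemma ML_G_bound {α : ℝ} (h1 : 1 < α) (h2 : α < 2) :
    ∃ K : ℝ, 0 < K ∧ ∀ s : ℂ, 0 < s.re →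
      ‖mlG α s‖ ≤ K * ‖s‖ ^ (α - 2) ∧ ‖mlG α s‖ ≤ K * ‖s‖ ^ (α - 3) := by
  have hk := ML_kappa h1 h2
  set κ := (1 + Real.cos (α * (Real.pi / 2))) / 2 with hκ
  refine ⟨2 / κ, by positivity, fun s hs => ?_⟩
  have hs0 : s ≠ 0 := by rintro rfl; simp at hs
  have hx : 0 < ‖s‖ := norm_pos_iff.2 hs0
  have hn : ‖s ^ (α:ℂ)‖ = ‖s‖ ^ α := Complex.norm_cpow_real s α
  have hb := ML_one_add h1 h2 hs
  rw [← hκ] at hb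
  have hnum : ‖(2 * α - 2 : ℂ) + (α - 2) * s ^ (α:ℂ)‖ ≤ 2 * (1 + ‖s‖^α) := by
    refine (norm_add_le _ _).trans ?_
    rw [norm_mul, hn]
    have e1 : ‖(2 * α - 2 : ℂ)‖ = 2 * α - 2 := by
      have : (2 * α - 2 : ℂ) = ((2 * α - 2 : ℝ) : ℂ) := by push_cast; rfl
      rw [this, Complex.norm_real, Real.norm_of_nonneg (by linarith)]
    have e2 : ‖(α - 2 : ℂ)‖ = 2 - α := by
      have : (α - 2 : ℂ) = ((α - 2 : ℝ) : ℂ) := by push_cast; rfl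
      rw [this, Complex.norm_real, Real.norm_of_nonpos (by linarith)]; ring
    rw [e1, e2]
    have : 0 ≤ ‖s‖ ^ α := by positivity
    nlinarith
  have hG : ‖mlG α s‖ ≤ 2 / κ * ((‖s‖^3)⁻¹ * (‖s‖^α)^2 / (1 + ‖s‖^α)) := by
    unfold mlG
    rw [norm_div, norm_mul, norm_mul, norm_inv, norm_pow, norm_pow, norm_pow, hn]
    have hA : 0 ≤ ‖s‖^α := by positivity
    calc _ ≤ (‖s‖ ^ 3)⁻¹ * ((‖s‖ ^ α) ^ 2 * (2 * (1 + ‖s‖^α))) / (κ * (1 + ‖s‖ ^ α) ^ 2) := by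
          gcongr
      _ = _ := by
          field_simp
  have hsplit : ‖s‖ ^ (α - 3) = (‖s‖^3)⁻¹ * ‖s‖^α := by
    rw [Real.rpow_sub hx]
    norm_cast
    field_simp
  have hsplit2 : ‖s‖ ^ (α - 2) = ‖s‖ * ((‖s‖^3)⁻¹ * ‖s‖^α) := by
    rw [← hsplit, mul_comm, ← Real.rpow_add_one hx.ne']; ring_nf
  have hA : 0 < ‖s‖^α := by positivity
  refine ⟨hG.trans ?_, hG.trans ?_⟩
  · rw [hsplit2]
    gcongr
    rw [div_le_iff₀ (by positivity)]
    have hkey : ‖s‖ ^ α ≤ ‖s‖ * (1 + ‖s‖^α) := by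
      rcases le_total ‖s‖ 1 with h | h
      · have : ‖s‖ ^ α ≤ ‖s‖ ^ (1:ℝ) := Real.rpow_le_rpow_of_exponent_ge hx h h1.le
        rw [Real.rpow_one] at this
        nlinarith
      · nlinarith
    calc (‖s‖ ^ 3)⁻¹ * (‖s‖ ^ α) ^ 2 = (‖s‖ ^ 3)⁻¹ * ‖s‖^α * ‖s‖^α := by ring
      _ ≤ (‖s‖ ^ 3)⁻¹ * ‖s‖^α * (‖s‖ * (1 + ‖s‖^α)) := by gcongr
      _ = _ := by ring
  · rw [hsplit]
    gcongr
    rw [div_le_iff₀ (by positivity)]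
    calc (‖s‖ ^ 3)⁻¹ * (‖s‖ ^ α) ^ 2 = (‖s‖ ^ 3)⁻¹ * ‖s‖^α * ‖s‖^α := by ring
      _ ≤ (‖s‖ ^ 3)⁻¹ * ‖s‖^α * (1 + ‖s‖^α) := by gcongr; linarith
      _ = _ := by ring

lemma ML_S_eq {α : ℝ} (h1 : 1 < α) (h2 : α < 2) {s : ℂ} (hs : 0 < s.re) :
    mlS α s = (2 - α) * s ^ (-((3 - α : ℝ) : ℂ)) + mlG α s := by
  have hs0 : s ≠ 0 := by rintro rfl; simp at hs
  have hne := ML_one_add_ne h1 h2 hs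
  have : s ^ (-((3 - α : ℝ) : ℂ)) = s ^ (α:ℂ) * (s ^ 3)⁻¹ := by
    have : (-((3 - α : ℝ) : ℂ)) = α - (3:ℕ) := by push_cast; ring
    rw [this, Complex.cpow_sub _ _ hs0, Complex.cpow_natCast, div_eq_mul_inv]
  rw [this, mlS, mlG]
  field_simp
  ring

lemma ML_sum_point {α : ℝ} (h1 : 1 < α) (h2 : α < 2) {s : ℂ} (hs : 2 ≤ s.re) :
    HasSum (fun k : ℕ => ((-1) ^ k * (α * k + 2)) * s ^ (-((α * k + 3 : ℝ) : ℂ))) (mlS α s) := by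
  have hs' : 0 < s.re := by linarith
  have hs0 : s ≠ 0 := by rintro rfl; simp at hs'
  have hne := ML_one_add_ne h1 h2 hs'
  have hA0 : s ^ (α:ℂ) ≠ 0 := by simp [Complex.cpow_eq_zero_iff, hs0]
  have hn : ‖s ^ (α:ℂ)‖ = ‖s‖ ^ α := Complex.norm_cpow_real s α
  have hnorm : 1 < ‖s‖ ^ α := by
    apply Real.one_lt_rpow _ (by linarith)
    have := Complex.re_le_norm s
    linarith
  have hx : ‖-(s ^ (α:ℂ))⁻¹‖ < 1 := by
    rw [norm_neg, norm_inv, hn]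
    exact inv_lt_one_of_one_lt₀ hnorm
  have g1 := (hasSum_coe_mul_geometric_of_norm_lt_one hx).mul_left (α:ℂ)
  have g2 := (hasSum_geometric_of_norm_lt_one hx).mul_left (2:ℂ)
  have g := (g1.add g2).mul_left ((s^3)⁻¹)
  have hfun : (fun k : ℕ => ((-1) ^ k * (α * k + 2)) * s ^ (-((α * k + 3 : ℝ) : ℂ))) =
      (fun i : ℕ => (s ^ 3)⁻¹ * ((α:ℂ) * (i * (-(s ^ (α:ℂ))⁻¹) ^ i) + 2 * (-(s ^ (α:ℂ))⁻¹) ^ i)) := by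
    funext k
    have : s ^ (-((α * k + 3 : ℝ) : ℂ)) = ((s ^ (α:ℂ)) ^ k)⁻¹ * (s^3)⁻¹ := by
      have : (((α * k + 3 : ℝ) : ℂ)) = α * k + (3:ℕ) := by push_cast; ring
      rw [Complex.cpow_neg, this, Complex.cpow_add _ _ hs0, Complex.cpow_natCast, Complex.cpow_mul_nat, mul_inv]
    rw [this, neg_pow (s ^ (α:ℂ))⁻¹, inv_pow]
    ring
  have hval : mlS α s = (s ^ 3)⁻¹ * ((α:ℂ) * (-(s ^ (α:ℂ))⁻¹ / (1 - -(s ^ (α:ℂ))⁻¹) ^ 2) + 2 * (1 - -(s ^ (α:ℂ))⁻¹)⁻¹) := by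
    have h3 : 1 - -(s ^ (α:ℂ))⁻¹ = (1 + s ^ (α:ℂ)) / s ^ (α:ℂ) := by field_simp; ring
    rw [h3, mlS]
    field_simp
    ring
  rw [hfun, hval]
  exact g

lemma ML_repr {α t : ℝ} (h1 : 1 < α) (h2 : α < 2) (ht : 0 < t) :
    ∫ ξ : ℝ, Complex.exp (((2:ℂ) + ξ * Complex.I) * t) * mlS α ((2:ℂ) + ξ * Complex.I) =
      2 * Real.pi * (t ^ 2 * mittagLeffler α 2 (-(t ^ α)) : ℝ) := by
  set F : ℕ → ℝ → ℂ := fun k ξ => ((-1) ^ k * (α * k + 2)) *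
    (Complex.exp (((2:ℂ) + ξ * Complex.I) * t) * ((2:ℂ) + ξ * Complex.I) ^ (-((α * k + 3 : ℝ) : ℂ))) with hF
  have hnE : ∀ ξ : ℝ, ‖Complex.exp (((2:ℂ) + ξ * Complex.I) * t)‖ = Real.exp (2 * t) := by
    intro ξ; rw [Complex.norm_exp]; simp
  have hint : ∀ w : ℝ, 1 < w → Integrable (fun ξ : ℝ => Complex.exp (((2:ℂ) + ξ * Complex.I) * t) * ((2:ℂ) + ξ * Complex.I) ^ (-(w:ℂ))) := by
    intro w hw
    refine (ML_lineInt hw).bdd_mul (c := Real.exp (2*t)) ?_ ?_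
    · apply Continuous.aestronglyMeasurable; fun_prop
    · exact Filter.Eventually.of_forall fun ξ => (hnE ξ).le
  have hw : ∀ k : ℕ, 1 < α * k + 3 := fun k => by
    have : 0 ≤ α * k := by positivity
    linarith
  have hFint : ∀ k, Integrable (F k) := fun k => (hint _ (hw k)).const_mul _
  set J : ℝ := ∫ ξ : ℝ, ‖Complex.exp (((2:ℂ) + ξ * Complex.I) * t) * ((2:ℂ) + ξ * Complex.I) ^ (-((3:ℝ):ℂ))‖ with hJ
  have hx : ‖((2:ℝ)^(-α))‖ < 1 := by
    rw [Real.norm_of_nonneg (by positivity)]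
    exact Real.rpow_lt_one_of_one_lt_of_neg (by norm_num) (by linarith)
  have hsum : Summable fun k => ∫ ξ, ‖F k ξ‖ := by
    have g1 := (hasSum_coe_mul_geometric_of_norm_lt_one hx).summable.mul_left α
    have g2 := (hasSum_geometric_of_norm_lt_one hx).summable.mul_left 2
    have g := (g1.add g2).mul_right J
    refine Summable.of_nonneg_of_le (fun k => integral_nonneg fun ξ => norm_nonneg _) (fun k => ?_) g
    rw [hJ, ← integral_const_mul]
    refine integral_mono (hFint k).norm (((hint 3 (by norm_num)).norm).const_mul _) fun ξ => ?_
    simp only [hF]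
    rw [norm_mul, norm_mul, norm_mul, norm_pow, norm_neg, norm_one, one_pow, one_mul, hnE]
    have e1 : ‖((α:ℂ) * k + 2)‖ = α * k + 2 := by
      have : ((α:ℂ) * k + 2) = ((α * k + 2 : ℝ) : ℂ) := by push_cast; rfl
      rw [this, Complex.norm_real, Real.norm_of_nonneg (by positivity)]
    rw [e1]
    have hn : 2 ≤ ‖(2:ℂ) + ξ * Complex.I‖ := by
      have := Complex.re_le_norm ((2:ℂ) + ξ * Complex.I)
      simpa using this
    have e2 : ‖((2:ℂ) + ξ * Complex.I) ^ (-((α * k + 3 : ℝ) : ℂ))‖ = ‖(2:ℂ) + ξ * Complex.I‖ ^ (-(α*k)) * ‖(2:ℂ) + ξ * Complex.I‖ ^ (-3:ℝ) := by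
      rw [← Real.rpow_add (by linarith)]
      have : (-((α * k + 3 : ℝ) : ℂ)) = ((-(α * k) + -3 : ℝ) : ℂ) := by push_cast; ring
      rw [this, Complex.norm_cpow_real]
    have e3 : ‖((2:ℂ) + ξ * Complex.I) ^ (-((3:ℝ) : ℂ))‖ = ‖(2:ℂ) + ξ * Complex.I‖ ^ (-3:ℝ) := by
      rw [← Complex.ofReal_neg, Complex.norm_cpow_real]
    rw [e2, norm_mul, hnE, e3]
    have e4 : ‖(2:ℂ) + ξ * Complex.I‖ ^ (-(α*k)) ≤ ((2:ℝ)^(-α))^k := by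
      rw [← Real.rpow_natCast, ← Real.rpow_mul (by norm_num), neg_mul]
      exact Real.rpow_le_rpow_of_nonpos (by norm_num) hn (by have : 0 ≤ α * k := by positivity
                                                             linarith)
    calc _ ≤ (α * k + 2) * (Real.exp (2*t) * (((2:ℝ)^(-α))^k * ‖(2:ℂ) + ξ * Complex.I‖ ^ (-3:ℝ))) := by
          gcongr
      _ = _ := by ring
  have key := hasSum_integral_of_summable_integral_norm hFint hsum
  have hR : (fun ξ : ℝ => ∑' k, F k ξ) = fun ξ : ℝ => Complex.exp (((2:ℂ) + ξ * Complex.I) * t) * mlS α ((2:ℂ) + ξ * Complex.I) := by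
    funext ξ
    have := (ML_sum_point h1 h2 (s := (2:ℂ) + ξ * Complex.I) (by simp)).mul_left (Complex.exp (((2:ℂ) + ξ * Complex.I) * t))
    rw [← this.tsum_eq]
    refine tsum_congr fun k => ?_
    simp only [hF]; ring
  rw [hR] at key
  have hterm : ∀ k, ∫ ξ, F k ξ = ((2 * Real.pi * (t ^ 2 * ((-(t^α))^k / Real.Gamma (α * k + 2))) : ℝ) : ℂ) := by
    intro k
    simp only [hF]
    rw [integral_const_mul, ML_inv (hw k) ht]
    have hp : 0 < α * k + 2 := by positivity
    have hG : 0 < Real.Gamma (α * k + 2) := Real.Gamma_pos_of_pos hp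
    have e1 : Real.Gamma (α * k + 3) = (α * k + 2) * Real.Gamma (α * k + 2) := by
      rw [← Real.Gamma_add_one hp.ne']; ring_nf
    have e2 : t ^ (α * k + 3 - 1) = (t ^ α)^k * t ^ 2 := by
      rw [← Real.rpow_natCast, ← Real.rpow_mul ht.le, ← Real.rpow_two, ← Real.rpow_add ht]; ring_nf
    have e3 : (2 * Real.pi * (t ^ 2 * ((-(t^α))^k / Real.Gamma (α * k + 2))) : ℝ) = ((-1)^k * (α * k + 2)) * (2 * Real.pi * (t ^ (α * k + 3 - 1) / Real.Gamma (α * k + 3))) := by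
      rw [e1, e2, neg_pow]
      field_simp
    rw [e3]; push_cast; ring
  simp_rw [hterm] at key
  rw [← key.tsum_eq, ← Complex.ofReal_tsum, tsum_mul_left, tsum_mul_left]
  simp only [mittagLeffler]
  push_cast
  ring

noncomputable def mlg (α : ℝ) (ξ : ℝ) : ℝ := if |ξ| ≤ 1 then |ξ| ^ (α - 2) else |ξ| ^ (α - 3)

lemma ML_g_int {α : ℝ} (h1 : 1 < α) (h2 : α < 2) : Integrable (mlg α) := by
  have hI : IntegrableOn (mlg α) (Ioi 0) := by
    rw [← Ioc_union_Ioi_eq_Ioi (zero_le_one' ℝ), integrableOn_union]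
    constructor
    · have := (intervalIntegral.intervalIntegrable_rpow' (a := 0) (b := 1) (r := α - 2) (by linarith))
      rw [intervalIntegrable_iff_integrableOn_Ioc_of_le zero_le_one] at this
      refine this.congr_fun (fun x hx => ?_) measurableSet_Ioc
      simp [mlg, abs_of_pos hx.1, hx.2]
    · refine (integrableOn_Ioi_rpow_of_lt (a := α - 3) (by linarith) one_pos).congr_fun (fun x hx => ?_) measurableSet_Ioi
      have hx' : (1:ℝ) < x := hx
      simp [mlg, abs_of_pos (zero_lt_one.trans hx'), not_le.2 hx']
  have heq : mlg α = fun x => mlg α |x| := by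
    funext x; simp [mlg]
  rw [heq]
  have h0 : IntegrableOn (fun x => mlg α |x|) (Ioi 0) := by rw [← heq]; exact hI
  have int_Iic : IntegrableOn (fun x => mlg α |x|) (Iic 0) := by
    rw [← Measure.map_neg_eq_self (volume : Measure ℝ)]
    let m : MeasurableEmbedding fun x : ℝ => -x := (Homeomorph.neg ℝ).measurableEmbedding
    rw [m.integrableOn_map_iff]
    simp_rw [Function.comp_def, abs_neg, neg_preimage, neg_Iic, neg_zero]
    exact Iff.mpr integrableOn_Ici_iff_integrableOn_Ioi h0
  rw [← integrableOn_univ, ← Iic_union_Ioi (a := (0:ℝ)), integrableOn_union]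
  exact ⟨int_Iic, h0⟩

lemma ML_G_diff {α : ℝ} (h1 : 1 < α) (h2 : α < 2) {s : ℂ} (hs : 0 < s.re) :
    DifferentiableAt ℂ (mlG α) s := by
  have hs0 : s ≠ 0 := by rintro rfl; simp at hs
  have hA : DifferentiableAt ℂ (fun z : ℂ => z ^ (α:ℂ)) s :=
    differentiableAt_id.cpow_const (Or.inl hs)
  unfold mlG
  refine DifferentiableAt.div (DifferentiableAt.mul (DifferentiableAt.inv (by fun_prop) (by positivity))
    ((hA.pow 2).mul ((differentiableAt_const _).add (hA.const_mul _)))) (((differentiableAt_const _).add hA).pow 2) ?_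
  exact pow_ne_zero _ (ML_one_add_ne h1 h2 hs)

lemma ML_line_bound {α K : ℝ} (h1 : 1 < α) (h2 : α < 2) (hK : 0 < K)
    (hb : ∀ s : ℂ, 0 < s.re → ‖mlG α s‖ ≤ K * ‖s‖ ^ (α - 2) ∧ ‖mlG α s‖ ≤ K * ‖s‖ ^ (α - 3))
    {c : ℝ} (hc : 0 < c) {ξ : ℝ} (hξ : ξ ≠ 0) :
    ‖mlG α ((c:ℂ) + ξ * Complex.I)‖ ≤ K * mlg α ξ := by
  have hs : 0 < ((c:ℂ) + ξ * Complex.I).re := by simpa using hc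
  have him : |ξ| ≤ ‖(c:ℂ) + ξ * Complex.I‖ := by
    simpa using Complex.abs_im_le_norm ((c:ℂ) + ξ * Complex.I)
  have hξ' : 0 < |ξ| := abs_pos.2 hξ
  unfold mlg
  split_ifs
  · refine (hb _ hs).1.trans ?_
    exact mul_le_mul_of_nonneg_left (Real.rpow_le_rpow_of_nonpos hξ' him (by linarith)) hK.le
  · refine (hb _ hs).2.trans ?_
    exact mul_le_mul_of_nonneg_left (Real.rpow_le_rpow_of_nonpos hξ' him (by linarith)) hK.le

lemma ML_ae_bound {α K : ℝ} (h1 : 1 < α) (h2 : α < 2) (hK : 0 < K)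
    (hb : ∀ s : ℂ, 0 < s.re → ‖mlG α s‖ ≤ K * ‖s‖ ^ (α - 2) ∧ ‖mlG α s‖ ≤ K * ‖s‖ ^ (α - 3))
    {c t : ℝ} (hc : 0 < c) :
    ∀ᵐ ξ : ℝ, ‖Complex.exp (((c:ℂ) + ξ * Complex.I) * t) * mlG α ((c:ℂ) + ξ * Complex.I)‖ ≤
      Real.exp (c * t) * (K * mlg α ξ) := by
  have : ∀ᵐ ξ : ℝ, ξ ≠ 0 := by
    rw [ae_iff]; simp
  filter_upwards [this] with ξ hξ
  rw [norm_mul, Complex.norm_exp]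
  have := ML_line_bound h1 h2 hK hb hc hξ
  have e : (((c:ℂ) + ξ * Complex.I) * t).re = c * t := by simp
  rw [e]
  gcongr

lemma ML_line_int {α K : ℝ} (h1 : 1 < α) (h2 : α < 2) (hK : 0 < K)
    (hb : ∀ s : ℂ, 0 < s.re → ‖mlG α s‖ ≤ K * ‖s‖ ^ (α - 2) ∧ ‖mlG α s‖ ≤ K * ‖s‖ ^ (α - 3))
    {c t : ℝ} (hc : 0 < c) :
    Integrable (fun ξ : ℝ => Complex.exp (((c:ℂ) + ξ * Complex.I) * t) * mlG α ((c:ℂ) + ξ * Complex.I)) := by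
  refine (((ML_g_int h1 h2).const_mul K).const_mul (Real.exp (c*t))).mono' ?_ (ML_ae_bound h1 h2 hK hb hc)
  apply Continuous.aestronglyMeasurable
  refine Continuous.mul (by fun_prop) ?_
  refine continuous_iff_continuousAt.2 fun ξ => ?_
  have hG := (ML_G_diff h1 h2 (s := (c:ℂ) + ξ * Complex.I) (by simpa using hc)).continuousAt
  exact ContinuousAt.comp (f := fun ξ : ℝ => (c:ℂ) + ξ * Complex.I) hG (by fun_prop)

lemma ML_shift {α K : ℝ} (h1 : 1 < α) (h2 : α < 2) (hK : 0 < K)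
    (hb : ∀ s : ℂ, 0 < s.re → ‖mlG α s‖ ≤ K * ‖s‖ ^ (α - 2) ∧ ‖mlG α s‖ ≤ K * ‖s‖ ^ (α - 3))
    {c t : ℝ} (hc : 0 < c) (hc2 : c ≤ 2) (ht : 0 < t) :
    ∫ ξ : ℝ, Complex.exp ((((2:ℝ):ℂ) + ξ * Complex.I) * t) * mlG α (((2:ℝ):ℂ) + ξ * Complex.I) =
    ∫ ξ : ℝ, Complex.exp (((c:ℂ) + ξ * Complex.I) * t) * mlG α ((c:ℂ) + ξ * Complex.I) := by
  set P : ℂ → ℂ := fun s => Complex.exp (s * t) * mlG α s with hP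
  have hrect : ∀ Y : ℝ, (∫ x : ℝ in c..2, P (x + ((-Y:ℝ):ℂ) * Complex.I)) - (∫ x : ℝ in c..2, P (x + (Y:ℂ) * Complex.I))
      + Complex.I • (∫ y : ℝ in (-Y)..Y, P (((2:ℝ):ℂ) + y * Complex.I)) - Complex.I • (∫ y : ℝ in (-Y)..Y, P ((c:ℂ) + y * Complex.I)) = 0 := by
    intro Y
    have := Complex.integral_boundary_rect_eq_zero_of_differentiableOn P ⟨c, -Y⟩ ⟨2, Y⟩ ?_
    · exact this
    · intro s hs
      have hre : 0 < s.re := by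
        have h := hs.1
        simp only [mem_preimage, uIcc_of_le hc2] at h
        exact lt_of_lt_of_le hc h.1
      exact (DifferentiableAt.mul (by fun_prop) (ML_G_diff h1 h2 hre)).differentiableWithinAt
  have hhor : ∀ Y : ℝ, 0 < |Y| → ‖∫ x : ℝ in c..2, P (x + (Y:ℂ) * Complex.I)‖ ≤ Real.exp (2 * t) * (K * |Y| ^ (α - 3)) * |2 - c| := by
    intro Y hY
    refine intervalIntegral.norm_integral_le_of_norm_le_const fun x hx => ?_
    rw [uIoc_of_le hc2] at hx
    have hx0 : 0 < x := hc.trans hx.1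
    have e : (((x:ℂ) + Y * Complex.I) * t).re = x * t := by simp
    have him : |Y| ≤ ‖(x:ℂ) + Y * Complex.I‖ := by
      simpa using Complex.abs_im_le_norm ((x:ℂ) + Y * Complex.I)
    simp only [hP]
    rw [norm_mul, Complex.norm_exp, e]
    gcongr
    · exact hx.2
    · refine (hb _ (by simpa using hx0)).2.trans ?_
      exact mul_le_mul_of_nonneg_left (Real.rpow_le_rpow_of_nonpos hY him (by linarith)) hK.le
  have hlim0 : Filter.Tendsto (fun Y : ℝ => Real.exp (2 * t) * (K * |Y| ^ (α - 3)) * |2 - c|) Filter.atTop (nhds 0) := by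
    have := tendsto_rpow_neg_atTop (y := 3 - α) (by linarith)
    have h := (((this.comp Filter.tendsto_abs_atTop_atTop).const_mul K).const_mul (Real.exp (2*t))).mul_const |2 - c|
    simpa [Function.comp_def] using h
  have hpos : ∀ᶠ Y : ℝ in Filter.atTop, 0 < |Y| := by
    filter_upwards [Filter.eventually_gt_atTop 0] with Y hY
    exact abs_pos.2 hY.ne'
  have hH1 : Filter.Tendsto (fun Y : ℝ => ∫ x : ℝ in c..2, P (x + (Y:ℂ) * Complex.I)) Filter.atTop (nhds 0) := by
    refine squeeze_zero_norm' ?_ hlim0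
    filter_upwards [hpos] with Y hY using hhor Y hY
  have hH2 : Filter.Tendsto (fun Y : ℝ => ∫ x : ℝ in c..2, P (x + ((-Y:ℝ):ℂ) * Complex.I)) Filter.atTop (nhds 0) := by
    refine squeeze_zero_norm' ?_ hlim0
    filter_upwards [hpos] with Y hY
    have := hhor (-Y) (by rwa [abs_neg])
    rwa [abs_neg] at this
  have hV : ∀ b : ℝ, 0 < b → Filter.Tendsto (fun Y : ℝ => ∫ y : ℝ in (-Y)..Y, P ((b:ℂ) + y * Complex.I)) Filter.atTop
      (nhds (∫ y : ℝ, P ((b:ℂ) + y * Complex.I))) := fun b hb' =>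
    intervalIntegral_tendsto_integral (ML_line_int h1 h2 hK hb hb') Filter.tendsto_neg_atTop_atBot Filter.tendsto_id
  have hall := ((hH2.sub hH1).add ((hV 2 (by norm_num)).const_smul Complex.I)).sub ((hV c hc).const_smul Complex.I)
  have hz := tendsto_nhds_unique (hall.congr hrect) tendsto_const_nhds
  simp only [sub_zero, zero_add, smul_eq_mul] at hz
  exact mul_left_cancel₀ Complex.I_ne_zero (sub_eq_zero.1 hz)

lemma ML_asymp {α : ℝ} (h1 : 1 < α) (h2 : α < 2) :
    ∃ C : ℝ, 0 < C ∧ ∀ t : ℝ, 1 ≤ t →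
      |t ^ 2 * mittagLeffler α 2 (-(t ^ α)) - t ^ (2 - α) / Real.Gamma (2 - α)| ≤ C := by
  obtain ⟨K, hK, hb⟩ := ML_G_bound h1 h2
  have hg0 : 0 ≤ ∫ ξ, mlg α ξ := integral_nonneg fun ξ => by
    simp only [mlg]; split_ifs <;> positivity
  refine ⟨Real.exp 1 * (K * ∫ ξ, mlg α ξ) + 1, by positivity, fun t ht => ?_⟩
  have ht0 : 0 < t := by linarith
  have hpi := Real.pi_pos
  have hG : 0 < Real.Gamma (2 - α) := Real.Gamma_pos_of_pos (by linarith)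
  have hrep := ML_repr h1 h2 ht0
  have hw : 1 < 3 - α := by linarith
  have hi := ML_inv hw ht0
  have hii : Integrable (fun ξ : ℝ => Complex.exp (((2:ℂ) + ξ * Complex.I) * t) * ((2:ℂ) + ξ * Complex.I) ^ (-((3 - α : ℝ):ℂ))) := by
    refine (ML_lineInt hw).bdd_mul (c := Real.exp (2*t)) ?_ ?_
    · apply Continuous.aestronglyMeasurable; fun_prop
    · refine Filter.Eventually.of_forall fun ξ => ?_
      rw [Complex.norm_exp]; simp
  have hGi := ML_line_int h1 h2 hK hb (c := 2) (t := t) (by norm_num)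
  have hsplit : ∀ ξ : ℝ, Complex.exp (((2:ℂ) + ξ * Complex.I) * t) * mlS α ((2:ℂ) + ξ * Complex.I) =
     (2 - α) * (Complex.exp (((2:ℂ) + ξ * Complex.I) * t) * ((2:ℂ) + ξ * Complex.I) ^ (-((3 - α : ℝ):ℂ))) + Complex.exp ((((2:ℝ):ℂ) + ξ * Complex.I) * t) * mlG α (((2:ℝ):ℂ) + ξ * Complex.I) := by
    intro ξ
    rw [ML_S_eq h1 h2 (by simp)]
    push_cast
    ring
  simp_rw [hsplit] at hrep
  have hct : 1 / t ≤ 2 := by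
    rw [div_le_iff₀ ht0]; linarith
  rw [integral_add (hii.const_mul _) hGi, integral_const_mul, hi, ML_shift h1 h2 hK hb (c := 1/t) (by positivity) hct ht0] at hrep
  have hbd : ‖∫ ξ : ℝ, Complex.exp ((((1/t:ℝ):ℂ) + ξ * Complex.I) * t) * mlG α (((1/t:ℝ):ℂ) + ξ * Complex.I)‖ ≤ Real.exp 1 * (K * ∫ ξ, mlg α ξ) := by
    rw [← integral_const_mul, ← integral_const_mul]
    refine norm_integral_le_of_norm_le (((ML_g_int h1 h2).const_mul K).const_mul _) ?_
    have := ML_ae_bound h1 h2 hK hb (c := 1/t) (t := t) (by positivity)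
    rwa [one_div_mul_cancel ht0.ne'] at this
  have e1 : Real.Gamma (3 - α) = (2 - α) * Real.Gamma (2 - α) := by
    rw [← Real.Gamma_add_one (by linarith)]; ring_nf
  have e2 : t ^ (3 - α - 1) = t ^ (2 - α) := by ring_nf
  have e3 : (∫ ξ : ℝ, Complex.exp ((((1/t:ℝ):ℂ) + ξ * Complex.I) * t) * mlG α (((1/t:ℝ):ℂ) + ξ * Complex.I)) =
      ((2 * Real.pi * (t ^ 2 * mittagLeffler α 2 (-(t ^ α)) - t ^ (2 - α) / Real.Gamma (2 - α)) : ℝ) : ℂ) := by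
    have e4 : t ^ (2 - α) / Real.Gamma (2 - α) = (2 - α) * (t ^ (3 - α - 1) / Real.Gamma (3 - α)) := by
      have : 2 - α ≠ 0 := by linarith
      rw [e1, e2]; field_simp
    rw [e4]
    rw [← eq_sub_iff_add_eq'] at hrep
    rw [hrep]; push_cast; ring
  rw [e3, Complex.norm_real, Real.norm_eq_abs, abs_mul, abs_of_pos (by positivity : 0 < 2 * Real.pi)] at hbd
  have h3 := Real.pi_gt_three
  nlinarith [abs_nonneg (t ^ 2 * mittagLeffler α 2 (-(t ^ α)) - t ^ (2 - α) / Real.Gamma (2 - α))]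

lemma ML_holder {u v : ℕ → ℝ} {p q : ℝ} (hp : 0 ≤ p) (hq : 0 < q) (hpq : p + q = 1)
    (hu : ∀ n, 0 ≤ u n) (hv : ∀ n, 0 ≤ v n) (hus : Summable u) (hvs : Summable v) :
    Summable (fun n => u n ^ p * v n ^ q) ∧
      ∑' n, u n ^ p * v n ^ q ≤ (∑' n, u n) ^ p * (∑' n, v n) ^ q := by
  rcases hp.eq_or_lt with h | h
  · have : q = 1 := by linarith
    subst this
    subst h
    simp [hvs]
  · have hc : (p⁻¹).HolderConjugate (q⁻¹) := by
      rw [Real.holderConjugate_iff]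
      refine ⟨?_, by simpa using hpq⟩
      exact (one_lt_inv₀ h).2 (by linarith)
    have e1 : ∀ n, (u n ^ p) ^ p⁻¹ = u n := fun n => Real.rpow_rpow_inv (hu n) h.ne'
    have e2 : ∀ n, (v n ^ q) ^ q⁻¹ = v n := fun n => Real.rpow_rpow_inv (hv n) hq.ne'
    have := Real.summable_and_inner_le_Lp_mul_Lq_tsum_of_nonneg hc
      (f := fun n => u n ^ p) (g := fun n => v n ^ q)
      (fun n => Real.rpow_nonneg (hu n) _) (fun n => Real.rpow_nonneg (hv n) _)
      (by simpa only [e1] using hus) (by simpa only [e2] using hvs)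
    simpa only [e1, e2, one_div, inv_inv] using this

lemma ML_unif {h : ℕ → ℝ} {d : ℝ} (hd : 0 < d) (hpos : ∀ n, 0 < h n)
    (hev : ∀ᶠ n in Filter.atTop, d ≤ h n) : ∃ δ : ℝ, 0 < δ ∧ ∀ n, δ ≤ h n := by
  obtain ⟨N, hN⟩ := Filter.eventually_atTop.1 hev
  have hfin : ∀ N : ℕ, ∃ δ : ℝ, 0 < δ ∧ ∀ n < N, δ ≤ h n := by
    intro N
    induction N with
    | zero => exact ⟨1, one_pos, by simp⟩
    | succ k ih =>
      obtain ⟨δ, h0, h1⟩ := ih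
      refine ⟨min δ (h k), lt_min h0 (hpos k), fun n hn => ?_⟩
      rcases Nat.lt_succ_iff_lt_or_eq.1 hn with hn | rfl
      · exact (min_le_left _ _).trans (h1 n hn)
      · exact min_le_right _ _
  obtain ⟨δ, h0, h1⟩ := hfin N
  refine ⟨min δ d, lt_min h0 hd, fun n => ?_⟩
  rcases lt_or_ge n N with hn | hn
  · exact (min_le_left _ _).trans (h1 n hn)
  · exact (min_le_right _ _).trans (hN n hn)

lemma ML_lower {α : ℝ} (h1 : 1 < α) (h2 : α < 2) :
    ∀ᶠ t : ℝ in Filter.atTop, 1 / (2 * Real.Gamma (2 - α)) ≤ t ^ α * mittagLeffler α 2 (-(t ^ α)) := by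
  obtain ⟨C, hC, hb⟩ := ML_asymp h1 h2
  have hG : 0 < Real.Gamma (2 - α) := Real.Gamma_pos_of_pos (by linarith)
  have htend := tendsto_rpow_atTop (y := 2 - α) (by linarith)
  filter_upwards [Filter.eventually_ge_atTop 1, htend.eventually_ge_atTop (2 * Real.Gamma (2 - α) * C)] with t ht hlarge
  have ht0 : 0 < t := by linarith
  have hx : 0 < t ^ (2 - α) := by positivity
  have e1 : t ^ 2 = t ^ (2 - α) * t ^ α := by
    rw [← Real.rpow_add ht0, ← Real.rpow_two]; ring_nf
  have h3 := (abs_le.1 (hb t ht)).1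
  rw [e1] at h3
  have h4 : C ≤ t ^ (2 - α) * (1 / (2 * Real.Gamma (2 - α))) := by
    rw [mul_one_div, le_div_iff₀ (by positivity)]; linarith
  have h5 : t ^ (2 - α) / Real.Gamma (2 - α) = 2 * (t ^ (2 - α) * (1 / (2 * Real.Gamma (2 - α)))) := by
    field_simp
  rw [h5] at h3
  refine le_of_mul_le_mul_left ?_ hx
  linarith

end MLaux

/-- conditional stability (Theorem 3.2, case `α ∈ (4/3,2)`) in Fourier
coefficients: for `T > 0` and a nondecreasing positive sequence `λ_n → ∞` with
`E_{α,2}(−λ_n T^α) ≠ 0` for all `n`, there is `C_T > 0` such that for every `M > 0`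
and every sequence `a` with `∑ λ_n^{2β} a_n² ≤ M²`, if `b_n = T E_{α,2}(−λ_n T^α) a_n`
and `∑ b_n²` converges, then
`∑ λ_n^{−2γ} a_n² ≤ C_T M^{2(1−γ)/(1+β)} (∑ b_n²)^{(β+γ)/(1+β)}`. -/
theorem conditional_stability_large_alpha (α β γ T : ℝ) (hα1 : 4 / 3 < α) (hα2 : α < 2)
    (hβ0 : 0 ≤ β) (hβ1 : β ≤ 1) (hγ0 : 0 ≤ γ) (hγ1 : γ ≤ 1) (hβγ : 0 < β + γ)
    (hT : 0 < T) (lam : ℕ → ℝ) (hmono : Monotone lam) (hpos : ∀ n, 0 < lam n)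
    (htend : Filter.Tendsto lam Filter.atTop Filter.atTop)
    (hne : ∀ n, mittagLeffler α 2 (-(lam n * T ^ α)) ≠ 0) :
    ∃ C : ℝ, 0 < C ∧
      ∀ M : ℝ, 0 < M → ∀ a : ℕ → ℝ,
      (Summable fun n => lam n ^ (2 * β) * a n ^ 2) →
      (∑' n, lam n ^ (2 * β) * a n ^ 2) ≤ M ^ 2 →
      (Summable fun n => (T * mittagLeffler α 2 (-(lam n * T ^ α)) * a n) ^ 2) →
      Summable (fun n => lam n ^ (-(2 * γ)) * a n ^ 2) ∧
      (∑' n, lam n ^ (-(2 * γ)) * a n ^ 2) ≤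
        C * M ^ (2 * (1 - γ) / (1 + β)) *
          (∑' n, (T * mittagLeffler α 2 (-(lam n * T ^ α)) * a n) ^ 2) ^ ((β + γ) / (1 + β)) := by
  have h1 : 1 < α := by linarith
  have hα0 : 0 < α := by linarith
  have hG : 0 < Real.Gamma (2 - α) := Real.Gamma_pos_of_pos (by linarith)
  have hTα : 0 < T ^ α := by positivity
  have hδ : ∃ δ : ℝ, 0 < δ ∧ ∀ n, δ ≤ lam n * |T * mittagLeffler α 2 (-(lam n * T ^ α))| := by
    refine ML_unif (d := T * (1 / (2 * Real.Gamma (2 - α))) / T ^ α) (by positivity)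
      (fun n => mul_pos (hpos n) (abs_pos.2 (mul_ne_zero hT.ne' (hne n)))) ?_
    have ht : Filter.Tendsto (fun n => lam n ^ (1 / α) * T) Filter.atTop Filter.atTop :=
      ((tendsto_rpow_atTop (by positivity : 0 < 1 / α)).comp htend).atTop_mul_const hT
    filter_upwards [ht.eventually (ML_lower h1 hα2)] with n hn
    have e : (lam n ^ (1 / α) * T) ^ α = lam n * T ^ α := by
      rw [Real.mul_rpow (Real.rpow_nonneg (hpos n).le _) hT.le, ← Real.rpow_mul (hpos n).le,
        one_div_mul_cancel hα0.ne', Real.rpow_one]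
    rw [e] at hn
    rw [div_le_iff₀ hTα]
    have h3 : T * mittagLeffler α 2 (-(lam n * T ^ α)) ≤ |T * mittagLeffler α 2 (-(lam n * T ^ α))| :=
      le_abs_self _
    have h4 := mul_le_mul_of_nonneg_left hn hT.le
    have h5 := mul_le_mul_of_nonneg_left h3 (mul_pos (hpos n) hTα).le
    linarith
  obtain ⟨δ, hδ0, hδ⟩ := hδ
  have hb1 : 0 < 1 + β := by linarith
  set p := (1 - γ) / (1 + β) with hp
  set q := (β + γ) / (1 + β) with hq
  have hp0 : 0 ≤ p := div_nonneg (by linarith) hb1.le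
  have hq0 : 0 < q := div_pos hβγ hb1
  have hpq : p + q = 1 := by
    rw [hp, hq, ← add_div, div_eq_one_iff_eq hb1.ne']; ring
  refine ⟨((δ ^ 2)⁻¹) ^ q, by positivity, fun M hM a hus huM hbs => ?_⟩
  set B := fun n => (T * mittagLeffler α 2 (-(lam n * T ^ α)) * a n) ^ 2 with hB
  have hv0 : ∀ n, 0 ≤ lam n ^ (-2 : ℝ) * a n ^ 2 := fun n =>
    mul_nonneg (Real.rpow_nonneg (hpos n).le _) (sq_nonneg _)
  have hu0 : ∀ n, 0 ≤ lam n ^ (2 * β) * a n ^ 2 := fun n =>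
    mul_nonneg (Real.rpow_nonneg (hpos n).le _) (sq_nonneg _)
  have hvB : ∀ n, lam n ^ (-2 : ℝ) * a n ^ 2 ≤ (δ ^ 2)⁻¹ * B n := by
    intro n
    have hl := hpos n
    have e : lam n ^ (-2 : ℝ) = (lam n ^ 2)⁻¹ := by
      rw [Real.rpow_neg hl.le, Real.rpow_two]
    have h3 : δ ^ 2 ≤ (lam n * |T * mittagLeffler α 2 (-(lam n * T ^ α))|) ^ 2 :=
      pow_le_pow_left₀ hδ0.le (hδ n) 2
    rw [mul_pow, sq_abs] at h3
    rw [e, inv_mul_eq_div, inv_mul_eq_div, div_le_div_iff₀ (by positivity) (by positivity)]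
    simp only [hB]
    have h4 := mul_le_mul_of_nonneg_right h3 (sq_nonneg (a n))
    rw [mul_pow (T * mittagLeffler α 2 (-(lam n * T ^ α)))]
    linarith
  have hvs : Summable fun n => lam n ^ (-2 : ℝ) * a n ^ 2 :=
    Summable.of_nonneg_of_le hv0 hvB (hbs.mul_left _)
  have hvt : (∑' n, lam n ^ (-2 : ℝ) * a n ^ 2) ≤ (δ ^ 2)⁻¹ * ∑' n, B n := by
    rw [← tsum_mul_left]
    exact hvs.tsum_le_tsum hvB (hbs.mul_left _)
  have hterm : ∀ n, (lam n ^ (2 * β) * a n ^ 2) ^ p * (lam n ^ (-2 : ℝ) * a n ^ 2) ^ q =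
      lam n ^ (-(2 * γ)) * a n ^ 2 := by
    intro n
    have hl := hpos n
    rw [Real.mul_rpow (by positivity) (by positivity), Real.mul_rpow (by positivity) (by positivity),
      ← Real.rpow_mul hl.le, ← Real.rpow_mul hl.le, mul_mul_mul_comm, ← Real.rpow_add hl,
      ← Real.rpow_add_of_nonneg (sq_nonneg _) hp0 hq0.le, hpq, Real.rpow_one]
    congr 2
    rw [hp, hq]
    field_simp
    ring
  obtain ⟨hs, hle⟩ := ML_holder hp0 hq0 hpq hu0 hv0 hus hvs
  simp only [hterm] at hs hle
  refine ⟨hs, hle.trans ?_⟩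
  have hB0 : 0 ≤ ∑' n, B n := tsum_nonneg fun n => sq_nonneg _
  have e1 : M ^ (2 * (1 - γ) / (1 + β)) = (M ^ 2) ^ p := by
    rw [← Real.rpow_two, ← Real.rpow_mul hM.le, hp, mul_div_assoc]
  rw [e1]
  have hu' : 0 ≤ ∑' n, lam n ^ (2 * β) * a n ^ 2 := tsum_nonneg hu0
  have hv' : 0 ≤ ∑' n, lam n ^ (-2 : ℝ) * a n ^ 2 := tsum_nonneg hv0
  calc _ ≤ (M ^ 2) ^ p * ((δ ^ 2)⁻¹ * ∑' n, B n) ^ q := by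
        exact mul_le_mul (Real.rpow_le_rpow hu' huM hp0) (Real.rpow_le_rpow hv' hvt hq0.le)
          (Real.rpow_nonneg hv' _) (by positivity)
    _ = _ := by
        rw [Real.mul_rpow (by positivity) hB0]; ring
end
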